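/- Let α > 1, let f ∈ A²_α(𝔻), and for κ > 0 set μ(κ) := m({z ∈ 𝔻 : u_f(z) > κ}). Then the function κ ↦ κ^{2/α} (−1 − μ(κ)) is nondecreasing on (0, sup u_f). Moreover, if f ∈ M₃, then this function is constant on (0, sup u_f). -/

import Mathlib

open MeasureTheory

/-- `u_f(z) = |f(z)| (1−|z|²)^{α/2}`. -/
noncomputable def uBerg (α : ℝ) (f : ℂ → ℂ) (z : ℂ) : ℝ :=
  ‖f z‖ * (1 - ‖z‖^2) ^ (α/2)

/-- The optimizer set `M₃`: the functions agreeing on `𝔻` with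
`z ↦ e^{iθ} (1−|w|²)^{α/2} (1 − conj(w) z)^{−α}` for some `w ∈ 𝔻`, `θ ∈ ℝ`. -/
def bergOpt (α : ℝ) : Set (ℂ → ℂ) :=
  {f | ∃ w : ℂ, ∃ θ : ℝ, ‖w‖ < 1 ∧ ∀ z ∈ Metric.ball (0:ℂ) 1,
    f z = Complex.exp (Complex.I * (θ:ℂ)) * ((((1 - ‖w‖^2) ^ (α/2) : ℝ)) : ℂ) *
      (1 - (starRingEnd ℂ) w * z) ^ (-(α:ℂ))}

/-- `μ(κ) = m({z ∈ 𝔻 : u_f(z) > κ})` where `dm(z) = π⁻¹ (1−|z|²)⁻² dA(z)`. -/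
noncomputable def muBerg (α : ℝ) (f : ℂ → ℂ) (κ : ℝ) : ℝ :=
  ∫ z in {z : ℂ | z ∈ Metric.ball (0:ℂ) 1 ∧ κ < uBerg α f z},
    Real.pi⁻¹ * ((1 - ‖z‖^2)^2)⁻¹

/-- The Möbius map `x ↦ ζ (1 - ȳ x) / (x - y)`, which for `‖ζ‖ = 1` sends `𝔻 \ {y}` onto the
exterior of the closed unit disk. -/
noncomputable def invMob (ζ y x : ℂ) : ℂ := ζ * (1 - (starRingEnd ℂ) y * x) / (x - y)

lemma one_sub_conj_mul_normSq (y x : ℂ) :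
    ‖1 - (starRingEnd ℂ) y * x‖ ^ 2 = ‖x - y‖ ^ 2 + (1 - ‖x‖ ^ 2) * (1 - ‖y‖ ^ 2) := by
  simp only [← Complex.normSq_eq_norm_sq, Complex.normSq_apply]
  simp
  ring

lemma invMob_normSq {ζ y x : ℂ} (hζ : ‖ζ‖ = 1) (hxy : x ≠ y) :
    ‖invMob ζ y x‖ ^ 2 - 1 = (1 - ‖x‖ ^ 2) * (1 - ‖y‖ ^ 2) / ‖x - y‖ ^ 2 := by
  have h : ‖x - y‖ ≠ 0 := norm_ne_zero_iff.2 (sub_ne_zero.2 hxy)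
  rw [invMob, norm_div, norm_mul, hζ, one_mul, div_pow, one_sub_conj_mul_normSq]
  field_simp
  ring

lemma hasDerivAt_invMob {ζ y x : ℂ} (hxy : x ≠ y) :
    HasDerivAt (invMob ζ y) (-ζ * (1 - ‖y‖ ^ 2 : ℝ) / (x - y) ^ 2) x := by
  have h : x - y ≠ 0 := sub_ne_zero.2 hxy
  have h1 : HasDerivAt (fun x => ζ * (1 - (starRingEnd ℂ) y * x))
      (ζ * (-((starRingEnd ℂ) y * 1))) x :=
    (((hasDerivAt_id x).const_mul _).const_sub 1).const_mul ζ
  have h2 := h1.div ((hasDerivAt_id x).sub_const y) h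
  refine h2.congr_deriv ?_
  have hy : ((‖y‖ ^ 2 : ℝ) : ℂ) = (starRingEnd ℂ) y * y := by
    rw [← Complex.normSq_eq_norm_sq, Complex.normSq_eq_conj_mul_self]
  simp only [Complex.ofReal_sub, Complex.ofReal_one, hy, id]
  field_simp
  ring

lemma abs_det_restrictScalars_toSpanSingleton (a : ℂ) :
    |((ContinuousLinearMap.toSpanSingleton ℂ a).restrictScalars ℝ).det| = ‖a‖ ^ 2 := by
  simp [ContinuousLinearMap.det, LinearMap.det_restrictScalars, Algebra.norm_complex_eq,
    Complex.normSq_eq_norm_sq]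

lemma injOn_invMob {ζ y : ℂ} (hζ : ‖ζ‖ = 1) (hy : ‖y‖ < 1) : Set.InjOn (invMob ζ y) {y}ᶜ := by
  intro a ha b hb hab
  have ha' : a - y ≠ 0 := sub_ne_zero.2 ha
  have hb' : b - y ≠ 0 := sub_ne_zero.2 hb
  have hζ0 : ζ ≠ 0 := by rintro rfl; simp at hζ
  have hyy : (1 - (starRingEnd ℂ) y * y) ≠ 0 := by
    rw [← Complex.normSq_eq_conj_mul_self, Complex.normSq_eq_norm_sq]
    norm_cast
    nlinarith [norm_nonneg y]
  simp only [invMob] at hab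
  rw [div_eq_div_iff ha' hb'] at hab
  have : ζ * (1 - (starRingEnd ℂ) y * y) * (b - a) = 0 := by linear_combination hab
  simp [hζ0, hyy, sub_eq_zero] at this
  exact this.symm

lemma image_invMob {ζ y : ℂ} (hζ : ‖ζ‖ = 1) (hy : ‖y‖ < 1) :
    invMob ζ y '' (Metric.ball 0 1 \ {y}) = {w | 1 < ‖w‖} := by
  have hy2 : 0 < 1 - ‖y‖ ^ 2 := by nlinarith [norm_nonneg y]
  have hζ0 : ζ ≠ 0 := by rintro rfl; simp at hζ
  have hyy : (1 - (starRingEnd ℂ) y * y) ≠ 0 := by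
    rw [← Complex.normSq_eq_conj_mul_self, Complex.normSq_eq_norm_sq]
    norm_cast
    nlinarith [norm_nonneg y]
  ext w
  constructor
  · rintro ⟨x, ⟨hx, hxy⟩, rfl⟩
    have hxy : x ≠ y := hxy
    have h := invMob_normSq (ζ := ζ) hζ hxy
    have hx1 : ‖x‖ < 1 := by simpa using hx
    have : 0 < ‖x - y‖ := norm_pos_iff.2 (sub_ne_zero.2 hxy)
    have h3 : 0 < (1 - ‖x‖ ^ 2) * (1 - ‖y‖ ^ 2) / ‖x - y‖ ^ 2 := by
      have : 0 < 1 - ‖x‖ ^ 2 := by nlinarith [norm_nonneg x]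
      positivity
    show 1 < ‖invMob ζ y x‖
    nlinarith [norm_nonneg (invMob ζ y x)]
  · intro hw
    have hw : 1 < ‖w‖ := hw
    have hden : w + ζ * (starRingEnd ℂ) y ≠ 0 := by
      intro h0
      have : ‖w‖ = ‖y‖ := by
        rw [eq_neg_of_add_eq_zero_left h0]; simp [hζ]
      linarith
    set x := (ζ + w * y) / (w + ζ * (starRingEnd ℂ) y) with hxdef
    have hxy' : x - y = ζ * (1 - (starRingEnd ℂ) y * y) / (w + ζ * (starRingEnd ℂ) y) := by
      rw [hxdef]; field_simp; ring
    have hxy : x ≠ y := by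
      rw [← sub_ne_zero, hxy']
      exact div_ne_zero (mul_ne_zero hζ0 hyy) hden
    have hT : invMob ζ y x = w := by
      have hne : x - y ≠ 0 := sub_ne_zero.2 hxy
      rw [invMob, div_eq_iff hne, hxy', hxdef]
      field_simp
      ring
    refine ⟨x, ⟨?_, hxy⟩, hT⟩
    have h := invMob_normSq (ζ := ζ) hζ hxy
    rw [hT] at h
    have h0 : 0 < ‖x - y‖ := norm_pos_iff.2 (sub_ne_zero.2 hxy)
    have h1 : 0 < (1 - ‖x‖ ^ 2) * (1 - ‖y‖ ^ 2) / ‖x - y‖ ^ 2 := by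
      rw [← h]; nlinarith
    have h2 : 0 < (1 - ‖x‖ ^ 2) * (1 - ‖y‖ ^ 2) := by
      by_contra hc
      exact absurd h1 (not_lt.2 (div_nonpos_of_nonpos_of_nonneg (not_lt.1 hc) (by positivity)))
    have h3 : 0 < 1 - ‖x‖ ^ 2 := pos_of_mul_pos_left h2 hy2.le
    simp only [Metric.mem_ball, dist_zero_right]
    nlinarith [norm_nonneg x]

/-- The density `(1 - |z|²)⁻²` of hyperbolic area. -/
noncomputable def hypDensity (z : ℂ) : ℝ := ((1 - ‖z‖ ^ 2) ^ 2)⁻¹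

lemma hypDensity_nonneg (z : ℂ) : 0 ≤ hypDensity z := by unfold hypDensity; positivity

lemma measurable_hypDensity : Measurable hypDensity := by unfold hypDensity; fun_prop

lemma lintegral_invMob {ζ y : ℂ} (hζ : ‖ζ‖ = 1) (hy : ‖y‖ < 1) (g : ℂ → ENNReal) :
    ∫⁻ x in Metric.ball 0 1, ENNReal.ofReal (hypDensity x) * g (invMob ζ y x) =
      ∫⁻ w in {w : ℂ | 1 < ‖w‖}, ENNReal.ofReal (hypDensity w) * g w := by
  have hs : MeasurableSet (Metric.ball (0 : ℂ) 1 \ {y}) :=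
    measurableSet_ball.diff (measurableSet_singleton y)
  have hy2 : 0 < 1 - ‖y‖ ^ 2 := by nlinarith [norm_nonneg y]
  rw [← image_invMob hζ hy, lintegral_image_eq_lintegral_abs_det_fderiv_mul volume hs
    (f' := fun x => (ContinuousLinearMap.toSpanSingleton ℂ
      (-ζ * (1 - ‖y‖ ^ 2 : ℝ) / (x - y) ^ 2)).restrictScalars ℝ)
    (fun x hx => ((hasDerivAt_invMob hx.2).hasFDerivAt.restrictScalars ℝ).hasFDerivWithinAt)
    ((injOn_invMob hζ hy).mono fun x hx => hx.2)]
  refine (setLIntegral_congr (sdiff_null_ae_eq_self (measure_singleton y))).symm.trans ?_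
  refine setLIntegral_congr_fun hs fun x hx => ?_
  have hxy : x ≠ y := hx.2
  have h0 : 0 < ‖x - y‖ := norm_pos_iff.2 (sub_ne_zero.2 hxy)
  simp only [abs_det_restrictScalars_toSpanSingleton]
  rw [← mul_assoc, ← ENNReal.ofReal_mul (by positivity)]
  congr 2
  have h1 := invMob_normSq (ζ := ζ) hζ hxy
  have hx1 : ‖x‖ < 1 := by simpa using hx.1
  have h2 : 0 < 1 - ‖x‖ ^ 2 := by nlinarith [norm_nonneg x]
  have : hypDensity (invMob ζ y x) = ((‖invMob ζ y x‖ ^ 2 - 1) ^ 2)⁻¹ := by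
    unfold hypDensity; ring
  rw [this, h1]
  simp only [hypDensity, norm_div, norm_mul, norm_neg, hζ, Complex.norm_real, norm_pow,
    Real.norm_of_nonneg hy2.le]
  field_simp

lemma integral_inv_sq_add_sq_sq {s : ℝ} (hs : 0 < s) :
    ∫⁻ b : ℝ, ENNReal.ofReal (((s ^ 2 + b ^ 2) ^ 2)⁻¹) = ENNReal.ofReal (Real.pi / (2 * s ^ 3)) := by
  set F : ℝ → ℝ := fun b => (Real.arctan (b / s) + s * b / (s ^ 2 + b ^ 2)) / (2 * s ^ 3) with hF
  have hder : ∀ b, HasDerivAt F (((s ^ 2 + b ^ 2) ^ 2)⁻¹) b := by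
    intro b
    have h1 : HasDerivAt (fun b => Real.arctan (b / s)) (1 / (1 + (b / s) ^ 2) * (1 / s)) b :=
      ((hasDerivAt_id b).div_const s).arctan
    have h2 : HasDerivAt (fun b => s * b / (s ^ 2 + b ^ 2))
        ((s * 1 * (s ^ 2 + b ^ 2) - s * b * (2 * b)) / (s ^ 2 + b ^ 2) ^ 2) b := by
      have := ((hasDerivAt_id b).const_mul s).div ((hasDerivAt_pow 2 b).const_add (s ^ 2))
        (by simp; positivity)
      exact this.congr_deriv (by simp)
    refine ((h1.add h2).div_const _).congr_deriv ?_
    field_simp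
    ring
  have hz : ∀ l : Filter ℝ, l ≤ Filter.cocompact ℝ →
      Filter.Tendsto (fun b => s * b / (s ^ 2 + b ^ 2)) l (nhds 0) := by
    intro l hl
    have h1 : Filter.Tendsto (fun b : ℝ => s * ‖b‖⁻¹) l (nhds 0) := by
      have := (tendsto_inv_atTop_zero.comp (tendsto_norm_cocompact_atTop.mono_left hl)).const_mul s
      simpa using this
    refine squeeze_zero_norm (fun b => ?_) h1
    rw [norm_div, norm_mul, Real.norm_of_nonneg hs.le,
      Real.norm_of_nonneg (by positivity : 0 ≤ s ^ 2 + b ^ 2)]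
    rcases eq_or_ne b 0 with rfl | hb
    · simp
    · have : 0 < ‖b‖ := norm_pos_iff.2 hb
      rw [mul_div_assoc]
      gcongr
      rw [← sq_abs b, ← Real.norm_eq_abs, div_le_iff₀ (by positivity)]
      field_simp
      nlinarith [sq_nonneg s]
  have htop : Filter.Tendsto F Filter.atTop (nhds ((Real.pi / 2 + 0) / (2 * s ^ 3))) := by
    refine (Filter.Tendsto.add ?_ (hz _ atTop_le_cocompact)).div_const _
    exact (Real.tendsto_arctan_atTop.mono_right nhdsWithin_le_nhds).comp
      (Filter.tendsto_id.atTop_div_const hs)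
  have hbot : Filter.Tendsto F Filter.atBot (nhds ((-(Real.pi / 2) + 0) / (2 * s ^ 3))) := by
    refine (Filter.Tendsto.add ?_ (hz _ atBot_le_cocompact)).div_const _
    exact (Real.tendsto_arctan_atBot.mono_right nhdsWithin_le_nhds).comp
      (Filter.tendsto_id.atBot_div_const hs)
  have hint : Integrable fun b : ℝ => ((s ^ 2 + b ^ 2) ^ 2)⁻¹ :=
    (integrable_inv_one_add_sq.comp_div hs.ne').const_mul (s ^ 4)⁻¹ |>.mono'
      (by fun_prop : Measurable _).aestronglyMeasurable (ae_of_all _ fun b => by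
        rw [Real.norm_of_nonneg (by positivity)]
        have : 0 ≤ b ^ 2 := sq_nonneg b
        rw [← mul_inv]
        gcongr
        field_simp
        nlinarith [sq_nonneg s])
  rw [← ofReal_integral_eq_lintegral_ofReal hint (ae_of_all _ fun b => by positivity),
    integral_of_hasDerivAt_of_tendsto hder hint hbot htop]
  congr 1
  field_simp
  ring

lemma lintegral_Ioi_sub_div {c : ℝ} (hc : 1 < c) :
    ∫⁻ a in Set.Ioi c, ENNReal.ofReal ((a - c) * (Real.pi / (2 * √(a ^ 2 - 1) ^ 3))) =
      ENNReal.ofReal (Real.pi / 2 * (c - √(c ^ 2 - 1))) := by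
  set F : ℝ → ℝ := fun a => Real.pi / 2 * ((c * a - 1) / √(a ^ 2 - 1)) with hF
  have hder : ∀ a ∈ Set.Ici c, HasDerivAt F ((a - c) * (Real.pi / (2 * √(a ^ 2 - 1) ^ 3))) a := by
    intro a ha
    have ha : c ≤ a := ha
    have hpos : 0 < a ^ 2 - 1 := by nlinarith
    have hsq : 0 < √(a ^ 2 - 1) := Real.sqrt_pos.2 hpos
    have h1 : HasDerivAt (fun a => √(a ^ 2 - 1)) (2 * a / (2 * √(a ^ 2 - 1))) a := by
      have := ((hasDerivAt_pow 2 a).sub_const 1).sqrt hpos.ne'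
      simpa using this
    have h2 := ((((hasDerivAt_id a).const_mul c).sub_const 1).div h1 hsq.ne').const_mul
      (Real.pi / 2)
    refine h2.congr_deriv ?_
    have h3 : √(a ^ 2 - 1) ^ 2 = a ^ 2 - 1 := Real.sq_sqrt hpos.le
    simp only [id]
    field_simp
    rw [h3]
    ring
  have htop : Filter.Tendsto F Filter.atTop (nhds (Real.pi / 2 * c)) := by
    refine Filter.Tendsto.const_mul _ ?_
    have h1 : Filter.Tendsto (fun a : ℝ => (c - a⁻¹) / √(1 - (a⁻¹) ^ 2)) Filter.atTop
        (nhds ((c - 0) / √(1 - 0 ^ 2))) := by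
      have h0 := tendsto_inv_atTop_zero (𝕜 := ℝ)
      refine (h0.const_sub c).div ?_ (by simp)
      exact ((h0.pow 2).const_sub 1).sqrt
    simp only [ne_eq, OfNat.ofNat_ne_zero, not_false_eq_true, zero_pow, sub_zero, Real.sqrt_one,
      div_one] at h1
    refine h1.congr' ?_
    filter_upwards [Filter.eventually_gt_atTop 1] with a ha
    have hpos : 0 < a ^ 2 - 1 := by nlinarith
    have : a ^ 2 - 1 = a ^ 2 * (1 - (a⁻¹) ^ 2) := by field_simp
    rw [this, Real.sqrt_mul (by positivity), Real.sqrt_sq (by positivity)]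
    have : c * a - 1 = a * (c - a⁻¹) := by field_simp
    rw [this, mul_div_mul_left _ _ (by positivity)]
  have hnn : ∀ a ∈ Set.Ioi c, 0 ≤ (a - c) * (Real.pi / (2 * √(a ^ 2 - 1) ^ 3)) := fun a ha =>
    mul_nonneg (sub_nonneg.2 (le_of_lt ha)) (by positivity)
  have hcont : ContinuousWithinAt F (Set.Ici c) c :=
    (hder c Set.self_mem_Ici).continuousAt.continuousWithinAt
  have hder' := fun a (ha : a ∈ Set.Ioi c) => hder a (Set.mem_Ici.2 (le_of_lt ha))
  have hint := integrableOn_Ioi_deriv_of_nonneg hcont hder' hnn htop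
  rw [← ofReal_integral_eq_lintegral_ofReal hint
      ((ae_restrict_iff' measurableSet_Ioi).2 (ae_of_all _ hnn)),
    integral_Ioi_of_hasDerivAt_of_tendsto hcont hder' hint htop]
  congr 1
  have hpos : 0 < c ^ 2 - 1 := by nlinarith
  have h3 : √(c ^ 2 - 1) ^ 2 = c ^ 2 - 1 := Real.sq_sqrt hpos.le
  have hsq : 0 < √(c ^ 2 - 1) := Real.sqrt_pos.2 hpos
  simp only [hF]
  field_simp
  linear_combination h3

lemma lintegral_halfPlane_le {c : ℝ} (hc : 1 < c) :
    ∫⁻ w in {w : ℂ | 1 < ‖w‖}, ENNReal.ofReal (hypDensity w) * ENNReal.ofReal (w.re - c) ≤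
      ENNReal.ofReal (Real.pi / 2 * (c - √(c ^ 2 - 1))) := by
  refine (setLIntegral_le_lintegral _ _).trans ?_
  have hm : Measurable fun w : ℂ =>
      ENNReal.ofReal (hypDensity w) * ENNReal.ofReal (w.re - c) :=
    measurable_hypDensity.ennreal_ofReal.mul
      (Complex.measurable_re.sub_const c).ennreal_ofReal
  rw [← Complex.volume_preserving_equiv_real_prod.symm.lintegral_comp hm, Measure.volume_eq_prod,
    lintegral_prod (fun p : ℝ × ℝ =>
      ENNReal.ofReal (hypDensity (Complex.measurableEquivRealProd.symm p)) *
        ENNReal.ofReal ((Complex.measurableEquivRealProd.symm p).re - c)) (hm.comp Complex.measurableEquivRealProd.symm.measurable).aemeasurable,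
    ← lintegral_Ioi_sub_div hc, ← lintegral_indicator measurableSet_Ioi]
  refine lintegral_mono fun a => ?_
  by_cases ha : c < a
  · have hpos : 0 < a ^ 2 - 1 := by nlinarith
    have hs : 0 < √(a ^ 2 - 1) := Real.sqrt_pos.2 hpos
    rw [Set.indicator_of_mem (Set.mem_Ioi.2 ha), ENNReal.ofReal_mul (sub_nonneg.2 ha.le),
      ← integral_inv_sq_add_sq_sq hs, ← lintegral_const_mul' _ _ ENNReal.ofReal_ne_top]
    refine lintegral_mono fun b => ?_
    dsimp only
    rw [mul_comm]
    refine mul_le_mul' le_rfl (le_of_eq ?_)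
    rw [Real.sq_sqrt hpos.le, hypDensity, ← Complex.normSq_eq_norm_sq, Complex.normSq_apply]
    simp only [Complex.measurableEquivRealProd_symm_apply]
    ring_nf
  · have : ∀ b : ℝ, ENNReal.ofReal ((Complex.measurableEquivRealProd.symm (a, b)).re - c) = 0 :=
      fun b => by
        rw [ENNReal.ofReal_eq_zero]
        simpa using ha
    simp only [this, mul_zero, lintegral_zero, zero_le]

/-- The bathtub bound: among sets of given hyperbolic area, `|∫ 1/φ_y|` is largest for a disk with
`y` on its boundary. -/
lemma norm_integral_invMob_le {y : ℂ} (hy : ‖y‖ < 1) {K : Set ℂ}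
    (hK1 : K ⊆ Metric.ball 0 1) (hKi : IntegrableOn hypDensity K) {M : ℝ}
    (hM : ∫ x in K, hypDensity x = Real.pi * M) (hM0 : 0 < M) :
    ‖∫ x in K, (hypDensity x : ℂ) * invMob 1 y x‖ ≤ Real.pi * √(M * (M + 1)) := by
  set J := ∫ x in K, (hypDensity x : ℂ) * invMob 1 y x with hJ
  by_cases hint : IntegrableOn (fun x => (hypDensity x : ℂ) * invMob 1 y x) K
  swap
  · rw [hJ, integral_undef hint, norm_zero]; positivity
  rcases eq_or_ne J 0 with hJ0 | hJ0
  · rw [hJ0, norm_zero]; positivity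
  set ζ : ℂ := (starRingEnd ℂ) J / ‖J‖ with hζdef
  have hJn : (‖J‖ : ℂ) ≠ 0 := by exact_mod_cast norm_ne_zero_iff.2 hJ0
  have hζ : ‖ζ‖ = 1 := by
    rw [hζdef, norm_div, RCLike.norm_conj, Complex.norm_real, norm_norm,
      div_self (norm_ne_zero_iff.2 hJ0)]
  have hinv : ∀ x, invMob ζ y x = ζ * invMob 1 y x := fun x => by simp only [invMob]; ring
  have hζJ : ζ * J = (‖J‖ : ℂ) := by
    rw [hζdef, div_mul_eq_mul_div, ← Complex.normSq_eq_conj_mul_self, Complex.normSq_eq_norm_sq]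
    field_simp
    push_cast
    ring
  have hint2 : IntegrableOn (fun x => (hypDensity x : ℂ) * invMob ζ y x) K := by
    refine (Integrable.const_mul hint ζ).congr (ae_of_all _ fun x => ?_)
    simp only [hinv]; ring
  have hre : IntegrableOn (fun x => hypDensity x * (invMob ζ y x).re) K := by
    refine hint2.re.congr (ae_of_all _ fun x => ?_)
    simp
  have hJre : ‖J‖ = ∫ x in K, hypDensity x * (invMob ζ y x).re := by
    have h1 : (∫ x in K, (hypDensity x : ℂ) * invMob ζ y x) = (‖J‖ : ℂ) := by
      rw [← hζJ, hJ, ← integral_const_mul]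
      refine integral_congr_ae (ae_of_all _ fun x => ?_)
      simp only [hinv]; ring
    have h2 := integral_re hint2
    simp only [h1] at h2
    simpa using h2.symm
  set s := √(M * (M + 1)) with hs
  have hs0 : 0 < s := Real.sqrt_pos.2 (by positivity)
  have hs2 : s ^ 2 = M * (M + 1) := Real.sq_sqrt (by positivity)
  set c := (2 * M + 1) / (2 * s) with hc
  have hc2 : c ^ 2 - 1 = (1 / (2 * s)) ^ 2 := by
    rw [hc]; field_simp; nlinarith
  have hcs : √(c ^ 2 - 1) = 1 / (2 * s) := by rw [hc2, Real.sqrt_sq (by positivity)]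
  have hc1 : 1 < c := by
    have h0 : 0 < (1 / (2 * s)) ^ 2 := by positivity
    have : 0 < c := by positivity
    nlinarith
  have hsub : IntegrableOn (fun x => hypDensity x * ((invMob ζ y x).re - c)) K := by
    refine (hre.sub (Integrable.mul_const hKi c)).congr (ae_of_all _ fun x => ?_)
    simp only [Pi.sub_apply]; ring
  have hmain : ∫ x in K, hypDensity x * ((invMob ζ y x).re - c) ≤
      Real.pi / 2 * (c - √(c ^ 2 - 1)) := by
    have hnn : 0 ≤ Real.pi / 2 * (c - √(c ^ 2 - 1)) := by
      have : √(c ^ 2 - 1) ≤ c := Real.sqrt_le_iff.2 ⟨by positivity, by linarith⟩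
      have := sub_nonneg.2 this
      positivity
    rw [integral_eq_lintegral_pos_part_sub_lintegral_neg_part hsub]
    refine (sub_le_self _ ENNReal.toReal_nonneg).trans ?_
    refine ENNReal.toReal_le_of_le_ofReal hnn ?_
    refine le_trans ?_ (lintegral_halfPlane_le hc1)
    rw [← lintegral_invMob hζ hy]
    refine (lintegral_mono_set hK1).trans (lintegral_mono fun x => ?_)
    rw [ENNReal.ofReal_mul (hypDensity_nonneg x)]
  have hsplit : ∫ x in K, hypDensity x * ((invMob ζ y x).re - c) = ‖J‖ - c * (Real.pi * M) := by
    rw [hJre, ← hM, ← integral_const_mul, ← integral_sub hre (Integrable.const_mul hKi c)]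
    refine integral_congr_ae (ae_of_all _ fun x => ?_)
    simp only; ring
  rw [hsplit, hcs] at hmain
  have hfin : c * (Real.pi * M) + Real.pi / 2 * (c - 1 / (2 * s)) = Real.pi * s := by
    rw [hc]; field_simp; nlinarith
  linarith

/-- Twice the antiholomorphic Wirtinger derivative. -/
noncomputable def wbar (g : ℂ → ℂ) (z : ℂ) : ℂ :=
  fderiv ℝ g z 1 + Complex.I * fderiv ℝ g z Complex.I

lemma integrable_mul_of_support_subset {S : Set ℂ} (hS : IsCompact S) {a b : ℂ → ℂ}
    (ha : Continuous a) (hs : Function.support a ⊆ S) (hb : ContinuousOn b S) :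
    Integrable fun z => a z * b z := by
  have hi : IntegrableOn (fun z => a z * b z) S :=
    (ha.continuousOn.mul hb).integrableOn_compact hS
  refine (integrableOn_iff_integrable_of_support_subset ?_).1 hi
  exact (Function.support_mul_subset_left _ _).trans hs

lemma continuous_wbar {h : ℂ → ℂ} (hh : ContDiff ℝ 1 h) : Continuous (wbar h) := by
  have hcont : Continuous (fderiv ℝ h) := hh.continuous_fderiv one_ne_zero
  unfold wbar
  fun_prop

lemma support_wbar_subset (h : ℂ → ℂ) : Function.support (wbar h) ⊆ tsupport h := by
  intro z hz
  refine support_fderiv_subset ℝ fun h0 => hz ?_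
  simp only [wbar, h0, _root_.zero_apply, mul_zero, add_zero]

lemma integral_wbar_mul {h q p : ℂ → ℂ} (hh : ContDiff ℝ 1 h) (hc : HasCompactSupport h)
    {q' : ℂ → (ℂ →L[ℝ] ℂ)} (hq : ∀ z ∈ tsupport h, HasFDerivAt q (q' z) z)
    (hq' : ContinuousOn q' (tsupport h))
    (hp : ∀ z ∈ tsupport h, q' z 1 + Complex.I * q' z Complex.I = p z) :
    ∫ z, wbar h z * q z = -∫ z, h z * p z := by
  have hqc : ContinuousOn q (tsupport h) := fun z hz => (hq z hz).continuousAt.continuousWithinAt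
  have hcont : Continuous (fderiv ℝ h) := hh.continuous_fderiv one_ne_zero
  have hsupp : ∀ v : ℂ, Function.support (fun z => fderiv ℝ h z v) ⊆ tsupport h := by
    intro v z hz
    refine support_fderiv_subset ℝ fun h0 => hz ?_
    simp only [h0, _root_.zero_apply]
  have I1 : ∀ v : ℂ, Integrable fun z => fderiv ℝ h z v * q z := fun v =>
    integrable_mul_of_support_subset hc (hcont.clm_apply continuous_const) (hsupp v) hqc
  have I2 : ∀ v : ℂ, Integrable fun z => h z * q' z v := fun v =>
    integrable_mul_of_support_subset hc hh.continuous subset_closure (hq'.clm_apply continuousOn_const)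
  have I3 : Integrable fun z => h z * q z := integrable_mul_of_support_subset hc hh.continuous subset_closure hqc
  have ibp : ∀ v : ℂ, ∫ z, h z * q' z v = -∫ z, fderiv ℝ h z v * q z := fun v =>
    integral_bilinear_hasFDerivAt_right_eq_neg_left_of_integrable
      (B := ContinuousLinearMap.mul ℝ ℂ) (I1 v) (I2 v) I3
      (fun z _ => (hh.differentiable one_ne_zero z).hasFDerivAt) hq
  have e1 : ∫ z, h z * p z = (∫ z, h z * q' z 1) + Complex.I * ∫ z, h z * q' z Complex.I := by
    rw [← integral_const_mul, ← integral_add (I2 _) ((I2 _).const_mul _)]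
    refine integral_congr_ae (ae_of_all _ fun z => ?_)
    by_cases hz : z ∈ tsupport h
    · simp only [← hp z hz]; ring
    · simp [image_eq_zero_of_notMem_tsupport hz]
  rw [e1, ibp, ibp]
  have e2 : ∫ z, wbar h z * q z =
      (∫ z, fderiv ℝ h z 1 * q z) + Complex.I * ∫ z, fderiv ℝ h z Complex.I * q z := by
    rw [← integral_const_mul, ← integral_add (I1 _) ((I1 _).const_mul _)]
    refine integral_congr_ae (ae_of_all _ fun z => ?_)
    simp only [wbar]; ring
  rw [e2]
  ring

/-- The real part of the Cauchy–Pompeiu formula for a real-valued test function. -/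
lemma integral_fderiv_div_normSq {h : ℂ → ℝ} (hh : ContDiff ℝ 1 h) (hc : HasCompactSupport h)
    (x : ℂ) : ∫ y, fderiv ℝ h y (y - x) / ‖y - x‖ ^ 2 = -(2 * Real.pi) * h x := by
  have h0 := integral_add_right_eq_self (μ := volume)
    (fun y : ℂ => fderiv ℝ h y (y - x) / ‖y - x‖ ^ 2) x
  simp only [add_sub_cancel_right] at h0
  rw [← h0, ← Complex.integral_comp_polarCoord_symm]
  set g : ℝ × ℝ → ℝ := fun p =>
    fderiv ℝ h (p.1 * (Real.cos p.2 + Real.sin p.2 * Complex.I) + x)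
      (Real.cos p.2 + Real.sin p.2 * Complex.I) with hg
  have hcont : Continuous (fderiv ℝ h) := hh.continuous_fderiv one_ne_zero
  have hgc : Continuous g := by
    simp only [hg]
    refine (hcont.comp (by fun_prop)).clm_apply (by fun_prop)
  have hpt : polarCoord.target = Set.Ioi (0 : ℝ) ×ˢ Set.Ioo (-Real.pi) Real.pi := rfl
  have hn : ∀ θ : ℝ, ‖(Real.cos θ + Real.sin θ * Complex.I : ℂ)‖ = 1 := fun θ => by
    have := Complex.norm_exp_ofReal_mul_I θ
    rwa [Complex.exp_mul_I, ← Complex.ofReal_cos, ← Complex.ofReal_sin] at this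
  have e1 : ∫ p in polarCoord.target, p.1 • (fderiv ℝ h (Complex.polarCoord.symm p + x)
      (Complex.polarCoord.symm p) / ‖Complex.polarCoord.symm p‖ ^ 2) =
      ∫ p in Set.Ioi (0 : ℝ) ×ˢ Set.Ioo (-Real.pi) Real.pi, g p := by
    rw [hpt]
    refine setIntegral_congr_fun (measurableSet_Ioi.prod measurableSet_Ioo) fun p hp => ?_
    have hp1 : 0 < p.1 := hp.1
    simp only [Complex.polarCoord_symm_apply, norm_mul, hn, Complex.norm_real, mul_one, hg,
      Real.norm_of_nonneg hp1.le]
    have : (p.1 * (Real.cos p.2 + Real.sin p.2 * Complex.I) : ℂ) =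
        p.1 • (Real.cos p.2 + Real.sin p.2 * Complex.I : ℂ) := by
      rw [Complex.real_smul]
    rw [this, map_smul]
    simp only [smul_eq_mul]
    field_simp
  rw [e1]
  obtain ⟨R, hR⟩ := hc.isCompact.isBounded.subset_closedBall x
  have hzero : ∀ p : ℝ × ℝ, R < |p.1| → g p = 0 ∧
      h (p.1 * (Real.cos p.2 + Real.sin p.2 * Complex.I) + x) = 0 := by
    intro p hp
    have hnot : (p.1 * (Real.cos p.2 + Real.sin p.2 * Complex.I) + x : ℂ) ∉ tsupport h := by
      intro hmem
      have := hR hmem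
      rw [Metric.mem_closedBall, dist_eq_norm, add_sub_cancel_right, norm_mul, hn, mul_one,
        Complex.norm_real, Real.norm_eq_abs] at this
      linarith
    refine ⟨?_, image_eq_zero_of_notMem_tsupport hnot⟩
    have := Function.notMem_support.1 fun hm => hnot (support_fderiv_subset ℝ hm)
    simp only [hg, this, _root_.zero_apply]
  have hint : IntegrableOn g (Set.Ioi (0 : ℝ) ×ˢ Set.Ioo (-Real.pi) Real.pi) := by
    have hK : IntegrableOn g (Set.Icc (-R) R ×ˢ Set.Icc (-Real.pi) Real.pi) :=
      hgc.continuousOn.integrableOn_compact (isCompact_Icc.prod isCompact_Icc)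
    refine hK.of_forall_sdiff_eq_zero (measurableSet_Ioi.prod measurableSet_Ioo) ?_
    rintro p ⟨hp1, hp2⟩
    refine (hzero p ?_).1
    by_contra! hle
    exact hp2 ⟨abs_le.1 hle, ⟨hp1.2.1.le, hp1.2.2.le⟩⟩
  rw [IntegrableOn, Measure.volume_eq_prod, ← Measure.prod_restrict] at hint
  rw [Measure.volume_eq_prod, ← Measure.prod_restrict, integral_prod_symm _ hint]
  have inner : ∀ θ : ℝ, ∫ r in Set.Ioi (0 : ℝ), g (r, θ) = -h x := by
    intro θ
    have hd : ∀ r : ℝ, HasDerivAt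
        (fun r : ℝ => h (r * (Real.cos θ + Real.sin θ * Complex.I) + x)) (g (r, θ)) r := by
      intro r
      have h1 : HasDerivAt (fun r : ℝ => (r * (Real.cos θ + Real.sin θ * Complex.I) + x : ℂ))
          (1 * (Real.cos θ + Real.sin θ * Complex.I)) r :=
        ((Complex.ofRealCLM.hasDerivAt (x := r)).mul_const _).add_const x
      rw [one_mul] at h1
      exact ((hh.differentiable one_ne_zero _).hasFDerivAt.comp_hasDerivAt r h1)
    have ht : Filter.Tendsto (fun r : ℝ => h (r * (Real.cos θ + Real.sin θ * Complex.I) + x))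
        Filter.atTop (nhds 0) := by
      refine tendsto_const_nhds.congr' ?_
      filter_upwards [Filter.eventually_gt_atTop R] with r hr
      exact (hzero (r, θ) (hr.trans_le (le_abs_self r))).2.symm
    have hi : IntegrableOn (fun r => g (r, θ)) (Set.Ioi 0) := by
      have hK : IntegrableOn (fun r => g (r, θ)) (Set.Icc (-R) R) :=
        (hgc.comp (by fun_prop : Continuous fun r : ℝ => (r, θ))).continuousOn.integrableOn_compact
          isCompact_Icc
      refine hK.of_forall_sdiff_eq_zero measurableSet_Ioi ?_
      rintro r ⟨hp1, hp2⟩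
      refine (hzero (r, θ) ?_).1
      by_contra! hle
      exact hp2 (abs_le.1 hle)
    rw [integral_Ioi_of_hasDerivAt_of_tendsto (hd 0).continuousAt.continuousWithinAt
      (fun r _ => hd r) hi ht]
    simp
  simp only [inner]
  simp only [integral_const, measureReal_restrict_apply MeasurableSet.univ, Set.univ_inter,
    Real.volume_real_Ioo_of_le (neg_le_self Real.pi_pos.le), smul_eq_mul]
  ring

lemma wbar_ofReal {h : ℂ → ℝ} {z : ℂ} (hh : DifferentiableAt ℝ h z) :
    wbar (fun z => (h z : ℂ)) z = fderiv ℝ h z 1 + Complex.I * fderiv ℝ h z Complex.I := by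
  have : HasFDerivAt (fun z => (h z : ℂ)) (Complex.ofRealCLM.comp (fderiv ℝ h z)) z :=
    Complex.ofRealCLM.hasFDerivAt.comp z hh.hasFDerivAt
  simp [wbar, this.fderiv]

lemma re_wbar_ofReal_div {h : ℂ → ℝ} {z : ℂ} (hh : DifferentiableAt ℝ h z) (w : ℂ) :
    (wbar (fun z => (h z : ℂ)) z / w).re = fderiv ℝ h z w / ‖w‖ ^ 2 := by
  have : fderiv ℝ h z w = w.re * fderiv ℝ h z 1 + w.im * fderiv ℝ h z Complex.I := by
    conv_lhs => rw [← Complex.re_add_im w]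
    have : (w.re + w.im * Complex.I : ℂ) = w.re • (1 : ℂ) + w.im • Complex.I := by simp
    rw [this, map_add, map_smul, map_smul, smul_eq_mul, smul_eq_mul]
  rw [wbar_ofReal hh, this, Complex.div_re, ← Complex.normSq_eq_norm_sq]
  simp
  ring

lemma integrableOn_norm_inv_ball (R : ℝ) :
    Integrable ((Metric.ball (0 : ℂ) R).indicator fun z => ‖z‖⁻¹) := by
  have h := integrable_fun_norm_addHaar (E := ℂ) volume (f := (Set.Iio R).indicator fun r => r⁻¹)
  have e : (fun z : ℂ => (Set.Iio R).indicator (fun r => r⁻¹) ‖z‖) =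
      (Metric.ball (0 : ℂ) R).indicator fun z => ‖z‖⁻¹ := by
    ext z
    by_cases hz : ‖z‖ < R
    · rw [Set.indicator_of_mem (by simpa using hz), Set.indicator_of_mem (by simpa using hz)]
    · rw [Set.indicator_of_notMem (by simpa using hz), Set.indicator_of_notMem (by simpa using hz)]
  rw [← e, h, Complex.finrank_real_complex]
  have h1 : IntegrableOn (fun _ : ℝ => (1 : ℝ)) (Set.Ioo 0 R) := by simp
  have h2 : IntegrableOn ((Set.Ioo 0 R).indicator fun _ : ℝ => (1 : ℝ)) (Set.Ioi 0) :=
    ((integrable_indicator_iff measurableSet_Ioo).2 h1).integrableOn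
  refine h2.congr_fun (fun r hr => ?_) measurableSet_Ioi
  have hr : 0 < r := hr
  by_cases hR : r < R
  · rw [Set.indicator_of_mem (Set.mem_Ioo.2 ⟨hr, hR⟩)]
    rw [Set.indicator_of_mem (Set.mem_Iio.2 hR)]
    simp [hr.ne']
  · simp [Set.indicator, hR]

/-- The real derivative of `y ↦ ȳ / (1 - |y|²)`. -/
noncomputable def fderivConjDiv (z : ℂ) : ℂ →L[ℝ] ℂ :=
  (((starRingEnd ℂ) z) ^ 2 * hypDensity z : ℂ) • ContinuousLinearMap.id ℝ ℂ +
    (hypDensity z : ℂ) • (Complex.conjCLE : ℂ →L[ℝ] ℂ)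

lemma continuousOn_hypDensity : ContinuousOn hypDensity (Metric.ball 0 1) := by
  unfold hypDensity
  refine ContinuousOn.inv₀ (by fun_prop) fun z hz => ?_
  have : ‖z‖ < 1 := by simpa using hz
  have : 0 < 1 - ‖z‖ ^ 2 := by nlinarith [norm_nonneg z]
  positivity

lemma continuousOn_fderivConjDiv : ContinuousOn fderivConjDiv (Metric.ball 0 1) := by
  have h1 : ContinuousOn (fun z => (hypDensity z : ℂ)) (Metric.ball 0 1) :=
    Complex.continuous_ofReal.comp_continuousOn continuousOn_hypDensity
  have h2 : Continuous fun z : ℂ => (starRingEnd ℂ) z := Complex.continuous_conj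
  unfold fderivConjDiv
  exact (((h2.continuousOn.pow 2).mul h1).smul continuousOn_const).add (h1.smul continuousOn_const)

lemma hasFDerivAt_conj_div {z : ℂ} (hz : ‖z‖ < 1) :
    HasFDerivAt (fun y : ℂ => (starRingEnd ℂ) y / ((1 - ‖y‖ ^ 2 : ℝ) : ℂ)) (fderivConjDiv z) z := by
  have hy : ∀ y : ℂ, ((1 - ‖y‖ ^ 2 : ℝ) : ℂ) = 1 - (starRingEnd ℂ) y * y := fun y => by
    rw [← Complex.normSq_eq_norm_sq, Complex.ofReal_sub, Complex.normSq_eq_conj_mul_self,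
      Complex.ofReal_one]
  have hpos : 0 < 1 - ‖z‖ ^ 2 := by nlinarith [norm_nonneg z]
  have hne : 1 - (starRingEnd ℂ) z * z ≠ 0 := by
    rw [← hy]; exact_mod_cast hpos.ne'
  have hd : (hypDensity z : ℂ) = ((1 - (starRingEnd ℂ) z * z) ^ 2)⁻¹ := by
    rw [← hy]; simp [hypDensity]
  simp only [hy, div_eq_mul_inv]
  have hC : HasFDerivAt (fun y : ℂ => (starRingEnd ℂ) y) (Complex.conjCLE : ℂ →L[ℝ] ℂ) z :=
    (Complex.conjCLE : ℂ →L[ℝ] ℂ).hasFDerivAt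
  have h1 := (hC.mul (hasFDerivAt_id (𝕜 := ℝ) z)).const_sub 1
  have h2 := ((hasDerivAt_inv hne).hasFDerivAt.restrictScalars ℝ).comp z h1
  refine (hC.mul h2).congr_fderiv ?_
  ext v
  simp [fderivConjDiv, hd]
  field_simp
  ring

lemma fderivConjDiv_wbar (z : ℂ) :
    fderivConjDiv z 1 + Complex.I * fderivConjDiv z Complex.I = 2 * hypDensity z := by
  simp [fderivConjDiv]
  linear_combination (((starRingEnd ℂ) z) ^ 2 * hypDensity z - (hypDensity z : ℂ)) * Complex.I_sq

lemma invMob_div_eq {y x : ℂ} (hy : ‖y‖ < 1) (hxy : y ≠ x) :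
    ((1 - ‖y‖ ^ 2 : ℝ) : ℂ)⁻¹ * invMob 1 y x =
      -((y - x)⁻¹ + (starRingEnd ℂ) y / ((1 - ‖y‖ ^ 2 : ℝ) : ℂ)) := by
  have hpos : 0 < 1 - ‖y‖ ^ 2 := by nlinarith [norm_nonneg y]
  have hy' : ((1 - ‖y‖ ^ 2 : ℝ) : ℂ) = 1 - (starRingEnd ℂ) y * y := by
    rw [← Complex.normSq_eq_norm_sq, Complex.ofReal_sub, Complex.normSq_eq_conj_mul_self,
      Complex.ofReal_one]
  have hne : 1 - (starRingEnd ℂ) y * y ≠ 0 := by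
    rw [← hy']; exact_mod_cast hpos.ne'
  rw [hy', invMob]
  have h1 : x - y ≠ 0 := sub_ne_zero.2 hxy.symm
  have h2 : y - x ≠ 0 := sub_ne_zero.2 hxy
  field_simp
  ring

lemma integrable_iso_kernel {a : ℂ → ℂ} (ha : Integrable a) (ha1 : ∀ y, a y ≠ 0 → ‖y‖ < 1)
    {K : Set ℂ} (hK : MeasurableSet K) (hK1 : K ⊆ Metric.ball 0 1) {c : ℝ}
    (hc : ∀ x ∈ K, hypDensity x ≤ c) :
    Integrable (fun p : ℂ × ℂ => (hypDensity p.1 : ℂ) * (a p.2 * invMob 1 p.2 p.1))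
      ((volume.restrict K).prod volume) := by
  have h0 := (ha.norm.convolution_integrand (ContinuousLinearMap.mul ℝ ℝ)
    (integrableOn_norm_inv_ball 2)).const_mul (2 * c)
  have e : (volume.restrict K).prod (volume : Measure ℂ) =
      ((volume : Measure ℂ).prod (volume : Measure ℂ)).restrict (K ×ˢ Set.univ) := by
    rw [← Measure.prod_restrict, Measure.restrict_univ]
  rw [e]
  refine (h0.mono_measure Measure.restrict_le_self).mono' ?_ ?_
  · refine AEStronglyMeasurable.restrict ?_
    have h1 : AEStronglyMeasurable (fun p : ℂ × ℂ => a p.2)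
        ((volume : Measure ℂ).prod (volume : Measure ℂ)) := ha.aestronglyMeasurable.comp_snd
    have h2 : Measurable fun p : ℂ × ℂ => (hypDensity p.1 : ℂ) :=
      (Complex.measurable_ofReal.comp (measurable_hypDensity.comp measurable_fst))
    have h3 : Measurable fun p : ℂ × ℂ => invMob 1 p.2 p.1 := by
      unfold invMob
      have : Measurable fun p : ℂ × ℂ => (starRingEnd ℂ) p.2 :=
        Complex.continuous_conj.measurable.comp measurable_snd
      fun_prop
    exact h2.aestronglyMeasurable.mul (h1.mul h3.aestronglyMeasurable)
  · refine (ae_restrict_mem (hK.prod MeasurableSet.univ)).mono fun p hp => ?_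
    have hpK : p.1 ∈ K := hp.1
    have hx : ‖p.1‖ < 1 := by simpa using hK1 hpK
    by_cases h : a p.2 = 0
    · simp [h]
    have hy := ha1 _ h
    have hm : p.1 - p.2 ∈ Metric.ball (0 : ℂ) 2 := by
      rw [mem_ball_zero_iff]; exact (norm_sub_le _ _).trans_lt (by linarith)
    rw [Set.indicator_of_mem hm]
    have hn : ‖1 - (starRingEnd ℂ) p.2 * p.1‖ ≤ 2 := by
      refine (norm_sub_le _ _).trans ?_
      rw [norm_mul, RCLike.norm_conj, norm_one]
      nlinarith [norm_nonneg p.1, norm_nonneg p.2]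
    have hi : ‖invMob 1 p.2 p.1‖ ≤ 2 * ‖p.1 - p.2‖⁻¹ := by
      rw [invMob, norm_div, one_mul, div_eq_mul_inv]
      gcongr
    rw [norm_mul, norm_mul, Complex.norm_real, Real.norm_of_nonneg (hypDensity_nonneg _)]
    have := hc _ hpK
    have hc0 : 0 ≤ c := (hypDensity_nonneg _).trans this
    calc hypDensity p.1 * (‖a p.2‖ * ‖invMob 1 p.2 p.1‖)
        ≤ c * (‖a p.2‖ * (2 * ‖p.1 - p.2‖⁻¹)) := by gcongr
      _ = _ := by simp only [ContinuousLinearMap.mul_apply']; ring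

/-- A smoothed form of the isoperimetric inequality in the hyperbolic disk. -/
lemma isoperimetric {h : ℂ → ℝ} (hh : ContDiff ℝ 1 h) (hc : HasCompactSupport h)
    (hs : tsupport h ⊆ Metric.ball 0 1) (h0 : ∀ z, 0 ≤ h z) {K : Set ℂ} (hK : MeasurableSet K)
    (hK1 : ∀ z ∈ K, h z = 1) {M : ℝ} (hM : ∫ x in K, hypDensity x = Real.pi * M) (hM0 : 0 < M) :
    2 * Real.pi * √(M * (M + 1)) ≤
      ∫ y, ‖wbar (fun z => (h z : ℂ)) y‖ * (1 - ‖y‖ ^ 2)⁻¹ := by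
  set hC : ℂ → ℂ := fun z => (h z : ℂ) with hhC
  have hCd : ContDiff ℝ 1 hC := Complex.ofRealCLM.contDiff.comp hh
  have htC : tsupport hC = tsupport h := by
    unfold tsupport
    congr 1
    ext z; simp [hhC]
  have hCc : HasCompactSupport hC := by rw [HasCompactSupport, htC]; exact hc
  have hGs : Function.support (wbar hC) ⊆ tsupport h := htC ▸ support_wbar_subset hC
  have hGc : Continuous (wbar hC) := continuous_wbar hCd
  have hrho : ∀ y ∈ tsupport h, ((1 - ‖y‖ ^ 2 : ℝ) : ℂ) ≠ 0 := fun y hy => by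
    have : ‖y‖ < 1 := by simpa using hs hy
    have : 0 < 1 - ‖y‖ ^ 2 := by nlinarith [norm_nonneg y]
    exact_mod_cast this.ne'
  set a : ℂ → ℂ := fun y => wbar hC y * ((1 - ‖y‖ ^ 2 : ℝ) : ℂ)⁻¹ with ha
  have hai : Integrable a := integrable_mul_of_support_subset hc hGc hGs
    (ContinuousOn.inv₀ (by fun_prop) hrho)
  have ha1 : ∀ y, a y ≠ 0 → ‖y‖ < 1 := fun y hy => by
    simpa using hs (hGs (left_ne_zero_of_mul hy))
  have hKt : K ⊆ tsupport h := fun z hz => subset_tsupport _ (by simp [hK1 z hz])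
  have hhyc : ContinuousOn hypDensity (tsupport h) := continuousOn_hypDensity.mono hs
  obtain ⟨c, hcb⟩ := (hc.isCompact.image_of_continuousOn hhyc).bddAbove
  have hKi : IntegrableOn hypDensity K :=
    (hhyc.integrableOn_compact hc.isCompact).mono_set hKt
  have hF := integrable_iso_kernel hai ha1 hK (hKt.trans hs)
    (c := c) fun x hx => hcb ⟨x, hKt hx, rfl⟩
  have hswap := integral_integral_swap
    (f := fun x y => (hypDensity x : ℂ) * (a y * invMob 1 y x)) hF
  have hup : ‖∫ y, ∫ x in K, (hypDensity x : ℂ) * (a y * invMob 1 y x)‖ ≤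
      (∫ y, ‖a y‖) * (Real.pi * √(M * (M + 1))) := by
    rw [← integral_mul_const]
    refine norm_integral_le_of_norm_le (hai.norm.mul_const _) (ae_of_all _ fun y => ?_)
    by_cases hy : a y = 0
    · simp [hy]
    have : ∫ x in K, (hypDensity x : ℂ) * (a y * invMob 1 y x) =
        a y * ∫ x in K, (hypDensity x : ℂ) * invMob 1 y x := by
      rw [← integral_const_mul]
      congr 1; ext x; ring
    rw [this, norm_mul]
    gcongr
    exact norm_integral_invMob_le (ha1 y hy) (hKt.trans hs) hKi hM hM0
  have hq := integral_wbar_mul (q := fun y => (starRingEnd ℂ) y / ((1 - ‖y‖ ^ 2 : ℝ) : ℂ))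
    (q' := fderivConjDiv) (p := fun z => 2 * hypDensity z) hCd hCc
    (fun z hz => hasFDerivAt_conj_div (by simpa using hs (htC ▸ hz)))
    (continuousOn_fderivConjDiv.mono (htC ▸ hs)) (fun z _ => fderivConjDiv_wbar z)
  have hqi : Integrable fun y => wbar hC y * ((starRingEnd ℂ) y / ((1 - ‖y‖ ^ 2 : ℝ) : ℂ)) :=
    integrable_mul_of_support_subset hc hGc hGs
      (Complex.continuous_conj.continuousOn.div (by fun_prop) hrho)
  set H : ℝ := ∫ z, h z * hypDensity z with hH
  have hqH : ∫ y, wbar hC y * ((starRingEnd ℂ) y / ((1 - ‖y‖ ^ 2 : ℝ) : ℂ)) = ((-(2 * H) : ℝ) : ℂ) := by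
    rw [hq, Complex.ofReal_neg, hH, ← integral_const_mul, ← integral_complex_ofReal]
    congr 2; ext z; simp [hhC]; ring
  have hhi : Integrable fun z => h z * hypDensity z := by
    have : IntegrableOn (fun z => h z * hypDensity z) (tsupport h) :=
      (hh.continuous.continuousOn.mul hhyc).integrableOn_compact hc.isCompact
    refine (integrableOn_iff_integrable_of_support_subset fun z hz => ?_).1 this
    exact subset_tsupport _ (left_ne_zero_of_mul hz)
  have hHM : Real.pi * M ≤ H := by
    rw [← hM, hH]
    calc ∫ x in K, hypDensity x = ∫ x in K, h x * hypDensity x :=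
          setIntegral_congr_fun hK fun x hx => by simp [hK1 x hx]
      _ ≤ _ := setIntegral_le_integral hhi
          (ae_of_all _ fun z => mul_nonneg (h0 z) (hypDensity_nonneg z))
  have hlow : (∫ x in K, ∫ y, (hypDensity x : ℂ) * (a y * invMob 1 y x)).re =
      Real.pi * M * (2 * Real.pi + 2 * H) := by
    have h1 : ∫ x in K, (∫ y, (hypDensity x : ℂ) * (a y * invMob 1 y x)).re =
        (∫ x in K, ∫ y, (hypDensity x : ℂ) * (a y * invMob 1 y x)).re :=
      integral_re hF.integral_prod_left
    rw [← hM, ← integral_mul_const, ← h1]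
    refine integral_congr_ae ?_
    filter_upwards [hF.prod_right_ae, ae_restrict_mem hK] with x hx hxK
    have hx1 : ‖x‖ < 1 := by simpa using hs (hKt hxK)
    have hx0 : (hypDensity x : ℂ) ≠ 0 := by
      have : 0 < 1 - ‖x‖ ^ 2 := by nlinarith [norm_nonneg x]
      have : 0 < hypDensity x := by unfold hypDensity; positivity
      exact_mod_cast this.ne'
    have hxi : Integrable fun y => a y * invMob 1 y x := by
      simpa only [← mul_assoc, inv_mul_cancel₀ hx0, one_mul] using
        hx.const_mul (hypDensity x : ℂ)⁻¹
    have hae : (fun y => a y * invMob 1 y x +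
        wbar hC y * ((starRingEnd ℂ) y / ((1 - ‖y‖ ^ 2 : ℝ) : ℂ))) =ᵐ[volume]
        fun y => -(wbar hC y / (y - x)) := by
      filter_upwards [Measure.ae_ne volume x] with y hy
      by_cases hG : wbar hC y = 0
      · simp [ha, hG]
      · have := invMob_div_eq (by simpa using hs (hGs hG)) hy
        simp only [ha, mul_assoc]
        rw [this]
        ring
    have hPi : Integrable fun y => wbar hC y / (y - x) := by
      simpa using ((hxi.add hqi).congr hae).neg
    have hP : (∫ y, wbar hC y / (y - x)).re = -(2 * Real.pi) := by
      have h2 : ∫ y, (wbar hC y / (y - x)).re = (∫ y, wbar hC y / (y - x)).re :=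
        integral_re hPi
      rw [← h2]
      simp only [hhC, re_wbar_ofReal_div ((hh.differentiable one_ne_zero) _)]
      rw [integral_fderiv_div_normSq hh hc, hK1 x hxK, mul_one]
    have hsum : (∫ y, a y * invMob 1 y x) +
        ∫ y, wbar hC y * ((starRingEnd ℂ) y / ((1 - ‖y‖ ^ 2 : ℝ) : ℂ)) =
        -∫ y, wbar hC y / (y - x) := by
      rw [← integral_add hxi hqi, integral_congr_ae hae, integral_neg]
    have hre := congrArg Complex.re hsum
    rw [hqH, Complex.add_re, Complex.ofReal_re, Complex.neg_re, hP] at hre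
    rw [integral_const_mul, Complex.re_ofReal_mul]
    congr 1
    linarith
  have hnorm : ∫ y, ‖a y‖ = ∫ y, ‖wbar hC y‖ * (1 - ‖y‖ ^ 2)⁻¹ := by
    refine integral_congr_ae (ae_of_all _ fun y => ?_)
    by_cases hG : wbar hC y = 0
    · simp [ha, hG]
    · have : ‖y‖ < 1 := by simpa using hs (hGs hG)
      have : 0 < 1 - ‖y‖ ^ 2 := by nlinarith [norm_nonneg y]
      simp only [ha]
      rw [norm_mul, norm_inv, Complex.norm_real, Real.norm_of_nonneg this.le]
  rw [← hnorm]
  have hfin := ((Complex.re_le_norm _).trans_eq (congrArg norm hswap)).trans hup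
  rw [hlow] at hfin
  set s := √(M * (M + 1)) with hs
  have hs0 : 0 < s := Real.sqrt_pos.2 (by positivity)
  have hs2 : s ^ 2 = M * (M + 1) := Real.sq_sqrt (by positivity)
  have hpi := Real.pi_pos
  have h3 : 2 * Real.pi * s * (Real.pi * s) ≤ (∫ y, ‖a y‖) * (Real.pi * s) := by
    refine le_trans ?_ hfin
    have : Real.pi * M * (2 * Real.pi + 2 * (Real.pi * M)) ≤
      Real.pi * M * (2 * Real.pi + 2 * H) := by gcongr
    refine le_trans (le_of_eq ?_) this
    linear_combination 2 * Real.pi ^ 2 * hs2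
  exact le_of_mul_le_mul_right h3 (by positivity)

lemma enorm_le_lintegral_angle {g : ℂ → ℂ} {z : ℂ} {d r : ℝ}
    (hg : DifferentiableOn ℂ g (Metric.ball z d)) (hr : 0 < r) (hrd : r < d) :
    ENNReal.ofReal (2 * Real.pi) * ‖g z‖ₑ ≤
      ∫⁻ θ in Set.Ioo (-Real.pi) Real.pi, ‖g (circleMap z r θ)‖ₑ := by
  have hd : DiffContOnCl ℂ g (Metric.ball z |r|) := by
    rw [abs_of_pos hr]
    exact (hg.mono (Metric.closedBall_subset_ball hrd)).diffContOnCl_ball subset_rfl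
  have h1 := hd.circleAverage
  rw [Real.circleAverage_eq_integral_add (-Real.pi), intervalIntegral.integral_comp_add_right
    (fun θ => g (circleMap z r θ)), zero_add, show 2 * Real.pi + -Real.pi = Real.pi by ring,
    intervalIntegral.integral_of_le (by linarith [Real.pi_pos]),
    integral_Ioc_eq_integral_Ioo] at h1
  have h2 : (2 * Real.pi) • g z = ∫ θ in Set.Ioo (-Real.pi) Real.pi, g (circleMap z r θ) := by
    rw [← h1, smul_smul, mul_inv_cancel₀ (by positivity), one_smul]
  have h3 : ENNReal.ofReal (2 * Real.pi) * ‖g z‖ₑ = ‖(2 * Real.pi) • g z‖ₑ := by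
    rw [enorm_smul, Real.enorm_of_nonneg (by positivity)]
  rw [h3, h2]
  exact enorm_integral_le_lintegral_enorm _

/-- The area mean value inequality for holomorphic functions. -/
lemma enorm_le_lintegral_ball {g : ℂ → ℂ} {z : ℂ} {d : ℝ} (hd : 0 < d)
    (hg : DifferentiableOn ℂ g (Metric.ball z d)) :
    ENNReal.ofReal (Real.pi * d ^ 2) * ‖g z‖ₑ ≤ ∫⁻ w in Metric.ball z d, ‖g w‖ₑ := by
  set G : ℂ → ENNReal := (Metric.ball z d).indicator fun w => ‖g w‖ₑ with hG
  have hGm : Measurable G := by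
    classical
    rw [hG, ← Set.piecewise_eq_indicator]
    exact ContinuousOn.measurable_piecewise hg.continuousOn.enorm continuousOn_const
      measurableSet_ball
  rw [← lintegral_indicator measurableSet_ball, ← lintegral_add_left_eq_self _ z,
    ← Complex.lintegral_comp_polarCoord_symm, polarCoord_target, Measure.volume_eq_prod,
    ← Measure.prod_restrict, lintegral_prod]
  swap
  · refine Measurable.aemeasurable ?_
    simp only [Complex.polarCoord_symm_apply]
    exact (ENNReal.measurable_ofReal.comp measurable_fst).smul (hGm.comp (by fun_prop))
  have h1 : ∫⁻ r in Set.Ioo 0 d, ENNReal.ofReal r * (ENNReal.ofReal (2 * Real.pi) * ‖g z‖ₑ) =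
      ENNReal.ofReal (Real.pi * d ^ 2) * ‖g z‖ₑ := by
    rw [lintegral_mul_const _ (by fun_prop), ← mul_assoc]
    congr 1
    rw [← ofReal_integral_eq_lintegral_ofReal, ← ENNReal.ofReal_mul, ← integral_Ioc_eq_integral_Ioo,
      ← intervalIntegral.integral_of_le hd.le, integral_id]
    · congr 1; ring
    · rw [← integral_Ioc_eq_integral_Ioo, ← intervalIntegral.integral_of_le hd.le, integral_id]
      nlinarith
    · exact (continuous_id.integrableOn_Icc).mono_set Set.Ioo_subset_Icc_self
    · exact (ae_restrict_mem measurableSet_Ioo).mono fun r hr => hr.1.le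
  rw [← h1]
  refine (lintegral_mono_set (t := Set.Ioi 0) (show Set.Ioo 0 d ⊆ Set.Ioi 0 from Set.Ioo_subset_Ioi_self)).trans' ?_
  refine setLIntegral_mono' measurableSet_Ioo fun r hr => ?_
  simp only [smul_eq_mul]
  rw [lintegral_const_mul]
  swap
  · simp only [Complex.polarCoord_symm_apply]
    exact hGm.comp (by fun_prop)
  gcongr
  refine (enorm_le_lintegral_angle hg hr.1 hr.2).trans_eq ?_
  congr 1; ext θ
  have : circleMap z r θ = z + Complex.polarCoord.symm (r, θ) := by
    rw [circleMap, Complex.polarCoord_symm_apply, Complex.exp_mul_I]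
    simp
  rw [← this, Set.indicator_of_mem]
  rw [Metric.mem_ball, dist_eq_norm, circleMap_sub_center, norm_circleMap_zero, abs_of_pos hr.1]
  exact hr.2

lemma rpow_le_of_mem {d x p : ℝ} (hd : 0 < d) (h1 : d ≤ x) (h2 : x ≤ 6 * d) :
    x ^ p ≤ 6 ^ |p| * d ^ p := by
  rcases le_total 0 p with hp | hp
  · rw [abs_of_nonneg hp, ← Real.mul_rpow (by norm_num) hd.le]
    exact Real.rpow_le_rpow (hd.le.trans h1) h2 hp
  · refine (Real.rpow_le_rpow_of_nonpos hd h1 hp).trans ?_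
    exact le_mul_of_one_le_left (by positivity) (Real.one_le_rpow (by norm_num) (abs_nonneg p))

lemma uBerg_sq {α : ℝ} {f : ℂ → ℂ} {z : ℂ} (hz : ‖z‖ < 1) :
    uBerg α f z ^ 2 = ‖f z‖ ^ 2 * (1 - ‖z‖ ^ 2) ^ α := by
  have hpos : 0 < 1 - ‖z‖ ^ 2 := by nlinarith [norm_nonneg z]
  rw [uBerg, mul_pow, ← Real.rpow_natCast ((1 - ‖z‖ ^ 2) ^ (α / 2)), ← Real.rpow_mul hpos.le]
  congr 2
  push_cast; ring

/-- The superlevel sets of `u_f` stay away from the unit circle. -/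
lemma exists_norm_le_of_le_uBerg {α : ℝ} {f : ℂ → ℂ}
    (hα : 0 < α) (hf : DifferentiableOn ℂ f (Metric.ball (0 : ℂ) 1))
    (hint : IntegrableOn (fun z : ℂ => ‖f z‖ ^ 2 * (1 - ‖z‖ ^ 2) ^ (α - 2))
      (Metric.ball (0 : ℂ) 1)) {t : ℝ} (ht : 0 < t) :
    ∃ r < 1, ∀ z ∈ Metric.ball (0 : ℂ) 1, t ≤ uBerg α f z → ‖z‖ ≤ r := by
  set C : ℝ := 6 ^ |2 - α| with hC
  have hC0 : 0 < C := by positivity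
  set ε : ℝ := t ^ 2 * Real.pi / (C * 4 ^ α) / 2 with hε
  have hε0 : 0 < ε := by positivity
  obtain ⟨δ, hδ0, hδ⟩ := exists_pos_setLIntegral_lt_of_measure_lt
    (μ := volume.restrict (Metric.ball (0 : ℂ) 1)) hint.lintegral_lt_top.ne
    (ε := ENNReal.ofReal ε) (by simpa using hε0)
  obtain ⟨η, hη0, hηδ⟩ : ∃ η : ℝ, 0 < η ∧ ENNReal.ofReal η ≤ δ := by
    refine ⟨(min δ 1).toReal, ENNReal.toReal_pos (by simp [hδ0.ne']) (by simp), ?_⟩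
    rw [ENNReal.ofReal_toReal (by simp)]
    exact min_le_left _ _
  refine ⟨1 - 2 * √(η / Real.pi), by linarith [Real.sqrt_pos.2 (div_pos hη0 Real.pi_pos)],
    fun z hz htz => ?_⟩
  by_contra! hlt
  have hz1 : ‖z‖ < 1 := by simpa using hz
  set d := (1 - ‖z‖) / 2 with hd
  have hd0 : 0 < d := by linarith
  have hdη : Real.pi * d ^ 2 < η := by
    have h1 : d < √(η / Real.pi) := by linarith
    have h2 := (Real.lt_sqrt hd0.le).1 h1
    rw [lt_div_iff₀ Real.pi_pos] at h2
    linarith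
  have hsub : Metric.ball z d ⊆ Metric.ball 0 1 := by
    refine Metric.ball_subset_ball' ?_
    rw [dist_zero_right]; linarith
  have hφ : ∫⁻ w in Metric.ball z d, ENNReal.ofReal (‖f w‖ ^ 2 * (1 - ‖w‖ ^ 2) ^ (α - 2)) <
      ENNReal.ofReal ε := by
    have := hδ (Metric.ball z d) ?_
    · rwa [Measure.restrict_restrict measurableSet_ball, Set.inter_eq_left.2 hsub] at this
    · refine (Measure.restrict_apply_le _ _).trans_lt (lt_of_lt_of_le ?_ hηδ)
      rw [Complex.volume_ball, ← ENNReal.ofReal_pow hd0.le, ← ENNReal.ofReal_coe_nnreal,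
        ← ENNReal.ofReal_mul (by positivity)]
      refine (ENNReal.ofReal_lt_ofReal_iff hη0).2 ?_
      simpa [mul_comm] using hdη
  have hle := enorm_le_lintegral_ball (g := fun w => f w ^ 2) hd0 ((hf.mono hsub).pow 2)
  have hmono : ∫⁻ w in Metric.ball z d, ‖f w ^ 2‖ₑ ≤ ENNReal.ofReal (C * d ^ (2 - α)) *
      ∫⁻ w in Metric.ball z d, ENNReal.ofReal (‖f w‖ ^ 2 * (1 - ‖w‖ ^ 2) ^ (α - 2)) := by
    rw [← lintegral_const_mul' _ _ ENNReal.ofReal_ne_top]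
    refine setLIntegral_mono' measurableSet_ball fun w hw => ?_
    rw [← ENNReal.ofReal_mul (by positivity), ← ofReal_norm, norm_pow]
    refine ENNReal.ofReal_le_ofReal ?_
    have h1 : ‖w‖ ≤ ‖z‖ + d := by
      have := norm_sub_norm_le w z
      have hw' : ‖w - z‖ < d := by simpa [dist_eq_norm] using hw
      linarith
    have h2 : ‖z‖ - d ≤ ‖w‖ := by
      have := norm_sub_norm_le z w
      have hw' : ‖w - z‖ < d := by simpa [dist_eq_norm] using hw
      rw [norm_sub_rev] at this
      linarith
    have hw0 := norm_nonneg w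
    have hpos : 0 < 1 - ‖w‖ ^ 2 := by nlinarith
    have h3 := rpow_le_of_mem (p := 2 - α) hd0 (x := 1 - ‖w‖ ^ 2) (by nlinarith) (by nlinarith)
    have h4 : (1 - ‖w‖ ^ 2) ^ (2 - α) * (1 - ‖w‖ ^ 2) ^ (α - 2) = 1 := by
      rw [← Real.rpow_add hpos]; simp
    calc ‖f w‖ ^ 2 = ‖f w‖ ^ 2 * ((1 - ‖w‖ ^ 2) ^ (2 - α) * (1 - ‖w‖ ^ 2) ^ (α - 2)) := by
          rw [h4, mul_one]
      _ ≤ ‖f w‖ ^ 2 * (C * d ^ (2 - α) * (1 - ‖w‖ ^ 2) ^ (α - 2)) := by gcongr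
      _ = _ := by ring
  have hfin : Real.pi * d ^ 2 * ‖f z‖ ^ 2 ≤ C * d ^ (2 - α) * ε := by
    have := (hle.trans hmono).trans (mul_le_mul_right hφ.le _)
    rw [← ofReal_norm, norm_pow, ← ENNReal.ofReal_mul (by positivity),
      ← ENNReal.ofReal_mul (by positivity)] at this
    exact (ENNReal.ofReal_le_ofReal_iff (by positivity)).1 this
  have hu := uBerg_sq (α := α) (f := f) hz1
  have hpos : 0 < 1 - ‖z‖ ^ 2 := by nlinarith [norm_nonneg z]
  have hz4 : (1 - ‖z‖ ^ 2) ^ α ≤ 4 ^ α * d ^ α := by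
    rw [← Real.mul_rpow (by norm_num) hd0.le]
    exact Real.rpow_le_rpow hpos.le (by nlinarith [norm_nonneg z]) hα.le
  have hdd : d ^ (2 - α) * d ^ α = d ^ 2 := by
    rw [← Real.rpow_add hd0]; simp
  have h5 : Real.pi * d ^ 2 * t ^ 2 ≤ Real.pi * d ^ 2 * (t ^ 2 / 2) := by
    calc Real.pi * d ^ 2 * t ^ 2 ≤ Real.pi * d ^ 2 * (‖f z‖ ^ 2 * (1 - ‖z‖ ^ 2) ^ α) := by
          rw [← hu]; gcongr
      _ = Real.pi * d ^ 2 * ‖f z‖ ^ 2 * (1 - ‖z‖ ^ 2) ^ α := by ring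
      _ ≤ C * d ^ (2 - α) * ε * (4 ^ α * d ^ α) := by gcongr
      _ = C * ε * 4 ^ α * (d ^ (2 - α) * d ^ α) := by ring
      _ = _ := by rw [hdd, hε]; field_simp
  have h6 : 0 < Real.pi * d ^ 2 * t ^ 2 := by have := Real.pi_pos; positivity
  linarith

lemma exists_cutoff {t s η : ℝ} (hη : 0 < η) (hts : 2 * η < s - t) :
    ∃ ψ Ψ : ℝ → ℝ, Continuous ψ ∧ (∀ x, HasDerivAt Ψ (ψ x) x) ∧ (∀ x, 0 ≤ ψ x) ∧
      (∀ x, ψ x ≤ (s - t - 2 * η)⁻¹) ∧ (∀ x ≤ t, ψ x = 0) ∧ (∀ x, s ≤ x → ψ x = 0) ∧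
      (∀ x ≤ t, Ψ x = 0) ∧ (∀ x, s ≤ x → Ψ x = 1) ∧ ∀ x, 0 ≤ Ψ x ∧ Ψ x ≤ 1 := by
  set φ : ℝ → ℝ := fun x => max 0 (min 1 (min (x - t) (s - x) / η)) with hφ
  have hφc : Continuous φ := by fun_prop
  have hφ0 : ∀ x, 0 ≤ φ x := fun x => le_max_left _ _
  have hφ1 : ∀ x, φ x ≤ 1 := fun x => max_le zero_le_one (min_le_left _ _)
  have hφt : ∀ x ≤ t, φ x = 0 := fun x hx => by
    refine max_eq_left ((min_le_right _ _).trans (div_nonpos_of_nonpos_of_nonneg ?_ hη.le))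
    exact (min_le_left _ _).trans (by linarith)
  have hφs : ∀ x, s ≤ x → φ x = 0 := fun x hx => by
    refine max_eq_left ((min_le_right _ _).trans (div_nonpos_of_nonpos_of_nonneg ?_ hη.le))
    exact (min_le_right _ _).trans (by linarith)
  have hii : ∀ a b, IntervalIntegrable φ volume a b := fun a b => hφc.intervalIntegrable a b
  set J := ∫ x in t..s, φ x with hJ
  have hJ1 : s - t - 2 * η ≤ J := by
    have h1 : ∫ x in (t + η)..(s - η), φ x = s - t - 2 * η := by
      rw [intervalIntegral.integral_congr (g := fun _ => (1 : ℝ))]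
      · simp; ring
      · intro x hx
        rw [Set.uIcc_of_le (by linarith)] at hx
        have : 1 ≤ min (x - t) (s - x) / η := by
          rw [le_div_iff₀ hη]
          refine le_min ?_ ?_ <;> linarith [hx.1, hx.2]
        simp [hφ, this]
    rw [← h1, hJ]
    exact intervalIntegral.integral_mono_interval (by linarith) (by linarith) (by linarith)
      (ae_of_all _ hφ0) (hii _ _)
  have hJ0 : 0 < J := by linarith
  have hz : ∀ x ≤ t, ∫ y in t..x, φ y = 0 := fun x hx => by
    rw [intervalIntegral.integral_congr (g := fun _ => (0 : ℝ))]
    · simp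
    · intro y hy
      rw [Set.uIcc_of_ge hx] at hy
      exact hφt y hy.2
  have ho : ∀ x, s ≤ x → ∫ y in t..x, φ y = J := fun x hx => by
    rw [← intervalIntegral.integral_add_adjacent_intervals (hii t s) (hii s x),
      intervalIntegral.integral_congr (a := s) (b := x) (g := fun _ => (0 : ℝ))]
    · simp [hJ]
    · intro y hy
      rw [Set.uIcc_of_le hx] at hy
      exact hφs y hy.1
  have hmono : Monotone fun x => ∫ y in t..x, φ y := by
    refine monotone_of_deriv_nonneg (fun x => ?_) fun x => ?_
    · exact (hφc.integral_hasStrictDerivAt t x).hasDerivAt.differentiableAt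
    · rw [(hφc.integral_hasStrictDerivAt t x).hasDerivAt.deriv]; exact hφ0 x
  refine ⟨fun x => φ x / J, fun x => (∫ y in t..x, φ y) / J, hφc.div_const _,
    fun x => (hφc.integral_hasStrictDerivAt t x).hasDerivAt.div_const _,
    fun x => div_nonneg (hφ0 x) hJ0.le, fun x => ?_, fun x hx => by simp [hφt x hx],
    fun x hx => by simp [hφs x hx], fun x hx => by simp [hz x hx],
    fun x hx => by simp [ho x hx, hJ0.ne'], fun x => ⟨div_nonneg ?_ hJ0.le, ?_⟩⟩
  · rw [div_le_iff₀ hJ0, inv_mul_eq_div, le_div_iff₀ (by linarith)]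
    nlinarith [hφ1 x, hφ0 x]
  · rw [← hz _ (min_le_right x t)]
    exact hmono (min_le_left x t)
  · rw [div_le_one hJ0, ← ho _ (le_max_right x s)]
    exact hmono (le_max_left x s)

/-- Twice the logarithmic `∂`-derivative of `u_f`. -/
noncomputable def logDerivBerg (α : ℝ) (f : ℂ → ℂ) (z : ℂ) : ℂ :=
  deriv f z / f z - α * ((starRingEnd ℂ) z / ((1 - ‖z‖ ^ 2 : ℝ) : ℂ))

lemma hasFDerivAt_uBerg {α : ℝ} {f : ℂ → ℂ} {z : ℂ} (hf : DifferentiableAt ℂ f z)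
    (hz : ‖z‖ < 1) (h0 : f z ≠ 0) :
    HasFDerivAt (uBerg α f)
      (uBerg α f z • (Complex.reCLM ∘L ContinuousLinearMap.mul ℝ ℂ (logDerivBerg α f z))) z := by
  have hpos : 0 < 1 - ‖z‖ ^ 2 := by nlinarith [norm_nonneg z]
  have hn : 0 < ‖f z‖ := norm_pos_iff.2 h0
  have h1 := (hf.hasDerivAt.hasFDerivAt.restrictScalars ℝ).norm_sq.sqrt (by positivity)
  have h2 := (((hasFDerivAt_id (𝕜 := ℝ) z).norm_sq.const_sub 1).rpow_const
    (p := α / 2) (Or.inl hpos.ne'))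
  have h3 := h1.mul h2
  have e : ((fun y => √(‖f y‖ ^ 2)) * fun y => (1 - ‖id y‖ ^ 2) ^ (α / 2)) = uBerg α f := by
    ext y; simp [uBerg]
  rw [e] at h3
  refine h3.congr_fderiv ?_
  ext v
  have hr : (1 - ‖z‖ ^ 2) ^ (α / 2 - 1) = (1 - ‖z‖ ^ 2) ^ (α / 2) / (1 - ‖z‖ ^ 2) := by
    rw [Real.rpow_sub hpos, Real.rpow_one]
  have hns : (f z).re * (f z).re + (f z).im * (f z).im = ‖f z‖ ^ 2 := by
    rw [← Complex.normSq_eq_norm_sq, Complex.normSq_apply]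
  have hq : (logDerivBerg α f z * v).re = ((starRingEnd ℂ) (f z) * (v * deriv f z)).re / ‖f z‖ ^ 2 -
      α * ((starRingEnd ℂ) z * v).re / (1 - ‖z‖ ^ 2) := by
    have : logDerivBerg α f z * v = ((starRingEnd ℂ) (f z) * (v * deriv f z)) / ((‖f z‖ ^ 2 : ℝ) : ℂ) -
        ((α * ((starRingEnd ℂ) z * v) : ℂ)) / ((1 - ‖z‖ ^ 2 : ℝ) : ℂ) := by
      have h4 : ((‖f z‖ ^ 2 : ℝ) : ℂ) = (starRingEnd ℂ) (f z) * f z := by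
        rw [← Complex.normSq_eq_norm_sq, Complex.normSq_eq_conj_mul_self]
      have h5 : (starRingEnd ℂ) (f z) ≠ 0 := by simpa using h0
      rw [logDerivBerg, h4]
      field_simp
    rw [this, Complex.sub_re, Complex.div_ofReal_re, Complex.div_ofReal_re, Complex.re_ofReal_mul]
  have hN : √(‖f z‖ ^ 2) = ‖f z‖ := Real.sqrt_sq hn.le
  simp only [_root_.add_apply, _root_.smul_apply,
    ContinuousLinearMap.comp_apply, _root_.neg_apply, ContinuousLinearMap.id_apply,
    ContinuousLinearMap.mul_apply', Complex.reCLM_apply, innerSL_apply_apply, hN, id_eq, hr, hq,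
    Complex.inner, uBerg, smul_eq_mul, nsmul_eq_mul, ContinuousLinearMap.coe_restrictScalars',
    ContinuousLinearMap.toSpanSingleton_apply]
  push_cast
  field_simp
  ring

/-- The superlevel set of `u_f`. -/
def superBerg (α : ℝ) (f : ℂ → ℂ) (κ : ℝ) : Set ℂ :=
  {z : ℂ | z ∈ Metric.ball (0 : ℂ) 1 ∧ κ < uBerg α f z}

lemma continuousOn_uBerg (α : ℝ) {f : ℂ → ℂ}
    (hf : ContinuousOn f (Metric.ball (0 : ℂ) 1)) :
    ContinuousOn (uBerg α f) (Metric.ball (0 : ℂ) 1) := by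
  refine hf.norm.mul (ContinuousOn.rpow_const (by fun_prop) fun z hz => Or.inl ?_)
  have : ‖z‖ < 1 := by simpa using hz
  nlinarith [norm_nonneg z]

lemma isOpen_superBerg (α : ℝ) {f : ℂ → ℂ} (hf : ContinuousOn f (Metric.ball (0 : ℂ) 1))
    (κ : ℝ) : IsOpen (superBerg α f κ) :=
  (continuousOn_uBerg α hf).isOpen_inter_preimage Metric.isOpen_ball isOpen_Ioi

lemma superBerg_anti (α : ℝ) (f : ℂ → ℂ) : Antitone (superBerg α f) :=
  fun _ _ h _ hz => ⟨hz.1, h.trans_lt hz.2⟩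

lemma setIntegral_superBerg (α : ℝ) (f : ℂ → ℂ) (κ : ℝ) :
    ∫ z in superBerg α f κ, hypDensity z = Real.pi * muBerg α f κ := by
  rw [muBerg, integral_const_mul, mul_inv_cancel_left₀ Real.pi_ne_zero]
  rfl

lemma isCompact_le_uBerg {α : ℝ} {f : ℂ → ℂ}
    (hα : 0 < α) (hf : DifferentiableOn ℂ f (Metric.ball (0 : ℂ) 1))
    (hint : IntegrableOn (fun z : ℂ => ‖f z‖ ^ 2 * (1 - ‖z‖ ^ 2) ^ (α - 2))
      (Metric.ball (0 : ℂ) 1)) {t : ℝ} (ht : 0 < t) :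
    IsCompact {z | z ∈ Metric.ball (0 : ℂ) 1 ∧ t ≤ uBerg α f z} := by
  obtain ⟨r, hr, h⟩ := exists_norm_le_of_le_uBerg hα hf hint ht
  have e : {z | z ∈ Metric.ball (0 : ℂ) 1 ∧ t ≤ uBerg α f z} =
      Metric.closedBall 0 r ∩ uBerg α f ⁻¹' Set.Ici t := by
    ext z
    refine ⟨fun hz => ⟨by simpa using h z hz.1 hz.2, hz.2⟩, fun hz => ⟨?_, hz.2⟩⟩
    exact Metric.closedBall_subset_ball hr hz.1
  rw [e]
  refine (isCompact_closedBall (0 : ℂ) r).of_isClosed_subset ?_ Set.inter_subset_left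
  exact ((continuousOn_uBerg α hf.continuousOn).mono
    (Metric.closedBall_subset_ball hr)).preimage_isClosed_of_isClosed Metric.isClosed_closedBall
    isClosed_Ici

lemma integrableOn_superBerg {α : ℝ} {f : ℂ → ℂ}
    (hα : 0 < α) (hf : DifferentiableOn ℂ f (Metric.ball (0 : ℂ) 1))
    (hint : IntegrableOn (fun z : ℂ => ‖f z‖ ^ 2 * (1 - ‖z‖ ^ 2) ^ (α - 2))
      (Metric.ball (0 : ℂ) 1)) {t : ℝ} (ht : 0 < t) :
    IntegrableOn hypDensity (superBerg α f t) :=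
  ((continuousOn_hypDensity.mono fun _ hz => hz.1).integrableOn_compact
    (isCompact_le_uBerg hα hf hint ht)).mono_set fun _ hz => ⟨hz.1, hz.2.le⟩

lemma muBerg_pos {α : ℝ} {f : ℂ → ℂ}
    (hα : 0 < α) (hf : DifferentiableOn ℂ f (Metric.ball (0 : ℂ) 1))
    (hint : IntegrableOn (fun z : ℂ => ‖f z‖ ^ 2 * (1 - ‖z‖ ^ 2) ^ (α - 2))
      (Metric.ball (0 : ℂ) 1)) {t : ℝ} (ht : 0 < t) (hne : (superBerg α f t).Nonempty) :
    0 < muBerg α f t := by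
  have hpos : 0 < ∫ z in superBerg α f t, hypDensity z := by
    refine (setIntegral_pos_iff_support_of_nonneg_ae (ae_of_all _ hypDensity_nonneg)
      (integrableOn_superBerg hα hf hint ht)).2 ?_
    have ho := isOpen_superBerg α hf.continuousOn t
    rw [Set.inter_eq_right.2]
    · exact ho.measure_pos _ hne
    · intro z hz
      have : ‖z‖ < 1 := by simpa using hz.1
      have : 0 < 1 - ‖z‖ ^ 2 := by nlinarith [norm_nonneg z]
      have : 0 < hypDensity z := by unfold hypDensity; positivity
      exact this.ne'
  rw [setIntegral_superBerg] at hpos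
  exact pos_of_mul_pos_right hpos Real.pi_pos.le

lemma contDiffAt_uBerg {α : ℝ} {f : ℂ → ℂ} {z : ℂ}
    (hf : DifferentiableOn ℂ f (Metric.ball (0 : ℂ) 1)) (hz : z ∈ Metric.ball (0 : ℂ) 1)
    (h0 : f z ≠ 0) : ContDiffAt ℝ 1 (uBerg α f) z := by
  have h1 : ContDiffAt ℝ 1 f z :=
    ((hf.analyticAt (Metric.isOpen_ball.mem_nhds hz)).contDiffAt).restrict_scalars ℝ
  have h2 : ContDiffAt ℝ 1 (fun z : ℂ => 1 - ‖z‖ ^ 2) z :=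
    contDiffAt_const.sub (contDiffAt_id.norm_sq ℝ)
  have hpos : 1 - ‖z‖ ^ 2 ≠ 0 := by
    have : ‖z‖ < 1 := by simpa using hz
    have : 0 < 1 - ‖z‖ ^ 2 := by nlinarith [norm_nonneg z]
    exact this.ne'
  exact (h1.norm ℝ h0).mul (h2.rpow_const_of_ne hpos)

/-- The `C¹` truncation of `u_f` obtained from a cutoff `Ψ`. -/
noncomputable def truncBerg (α : ℝ) (f : ℂ → ℂ) (Ψ : ℝ → ℝ) : ℂ → ℝ :=
  (Metric.ball (0 : ℂ) 1).indicator fun z => Ψ (uBerg α f z)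

section
variable {α : ℝ} {f : ℂ → ℂ} {Ψ ψ : ℝ → ℝ} {t : ℝ}

lemma tsupport_truncBerg (hα : 0 < α) (hf : DifferentiableOn ℂ f (Metric.ball (0 : ℂ) 1))
    (hint : IntegrableOn (fun z : ℂ => ‖f z‖ ^ 2 * (1 - ‖z‖ ^ 2) ^ (α - 2))
      (Metric.ball (0 : ℂ) 1)) (ht : 0 < t) (hΨ0 : ∀ x ≤ t, Ψ x = 0) :
    tsupport (truncBerg α f Ψ) ⊆ {z | z ∈ Metric.ball (0 : ℂ) 1 ∧ t ≤ uBerg α f z} := by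
  refine closure_minimal (fun z hz => ?_) (isCompact_le_uBerg hα hf hint ht).isClosed
  have hz1 : z ∈ Metric.ball (0 : ℂ) 1 := Set.mem_of_indicator_ne_zero hz
  refine ⟨hz1, ?_⟩
  by_contra! h
  exact hz (by rw [truncBerg, Set.indicator_of_mem hz1, hΨ0 _ h.le])

lemma truncBerg_eventuallyEq {z : ℂ} (hz : z ∈ Metric.ball (0 : ℂ) 1) :
    truncBerg α f Ψ =ᶠ[nhds z] fun z => Ψ (uBerg α f z) := by
  filter_upwards [Metric.isOpen_ball.mem_nhds hz] with w hw
  rw [truncBerg, Set.indicator_of_mem hw]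

lemma ne_zero_of_le_uBerg (ht : 0 < t) {z : ℂ} (h : t ≤ uBerg α f z) : f z ≠ 0 := by
  intro h0
  rw [uBerg, h0, norm_zero, zero_mul] at h
  linarith

lemma contDiff_truncBerg (hα : 0 < α) (hf : DifferentiableOn ℂ f (Metric.ball (0 : ℂ) 1))
    (hint : IntegrableOn (fun z : ℂ => ‖f z‖ ^ 2 * (1 - ‖z‖ ^ 2) ^ (α - 2))
      (Metric.ball (0 : ℂ) 1)) (ht : 0 < t) (hΨ0 : ∀ x ≤ t, Ψ x = 0) (hψ : Continuous ψ)
    (hΨ : ∀ x, HasDerivAt Ψ (ψ x) x) : ContDiff ℝ 1 (truncBerg α f Ψ) := by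
  have hΨc : ContDiff ℝ 1 Ψ := by
    rw [contDiff_one_iff_deriv]
    refine ⟨fun x => (hΨ x).differentiableAt, ?_⟩
    rwa [show deriv Ψ = ψ from funext fun x => (hΨ x).deriv]
  rw [contDiff_iff_contDiffAt]
  intro z
  by_cases hz : z ∈ tsupport (truncBerg α f Ψ)
  · obtain ⟨hz1, hz2⟩ := tsupport_truncBerg hα hf hint ht hΨ0 hz
    refine ContDiffAt.congr_of_eventuallyEq ?_ (truncBerg_eventuallyEq hz1)
    exact hΨc.contDiffAt.comp z (contDiffAt_uBerg hf hz1 (ne_zero_of_le_uBerg ht hz2))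
  · exact contDiffAt_const.congr_of_eventuallyEq (notMem_tsupport_iff_eventuallyEq.1 hz)

lemma wbar_truncBerg (hα : 0 < α) (hf : DifferentiableOn ℂ f (Metric.ball (0 : ℂ) 1))
    (hint : IntegrableOn (fun z : ℂ => ‖f z‖ ^ 2 * (1 - ‖z‖ ^ 2) ^ (α - 2))
      (Metric.ball (0 : ℂ) 1)) (ht : 0 < t) (hΨ0 : ∀ x ≤ t, Ψ x = 0)
    (hΨ : ∀ x, HasDerivAt Ψ (ψ x) x) {z : ℂ} (hz : z ∈ tsupport (truncBerg α f Ψ)) :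
    wbar (fun z => (truncBerg α f Ψ z : ℂ)) z =
      (ψ (uBerg α f z) * uBerg α f z : ℝ) * (starRingEnd ℂ) (logDerivBerg α f z) := by
  obtain ⟨hz1, hz2⟩ := tsupport_truncBerg hα hf hint ht hΨ0 hz
  have h1 := (hΨ (uBerg α f z)).comp_hasFDerivAt z (hasFDerivAt_uBerg (α := α)
    (hf.differentiableAt (Metric.isOpen_ball.mem_nhds hz1)) (by simpa using hz1)
    (ne_zero_of_le_uBerg ht hz2))
  have h2 := h1.congr_of_eventuallyEq (truncBerg_eventuallyEq hz1)
  rw [wbar_ofReal h2.differentiableAt, h2.fderiv]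
  apply Complex.ext <;> simp <;> ring

end

section
variable {α : ℝ} {f : ℂ → ℂ} {Ψ ψ : ℝ → ℝ} {t s : ℝ}

lemma integral_wbar_truncBerg (hα : 0 < α) (hf : DifferentiableOn ℂ f (Metric.ball (0 : ℂ) 1))
    (hint : IntegrableOn (fun z : ℂ => ‖f z‖ ^ 2 * (1 - ‖z‖ ^ 2) ^ (α - 2))
      (Metric.ball (0 : ℂ) 1)) (ht : 0 < t) (hΨ0 : ∀ x ≤ t, Ψ x = 0) (hψ : Continuous ψ)
    (hΨ : ∀ x, HasDerivAt Ψ (ψ x) x) (hψ0 : ∀ x, 0 ≤ ψ x) :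
    Integrable (fun z => ‖wbar (fun z => (truncBerg α f Ψ z : ℂ)) z‖ * ‖logDerivBerg α f z‖) ∧
    ∫ z, ‖wbar (fun z => (truncBerg α f Ψ z : ℂ)) z‖ * ‖logDerivBerg α f z‖ =
      2 * α * ∫ z, truncBerg α f Ψ z * hypDensity z := by
  have hh := contDiff_truncBerg hα hf hint ht hΨ0 hψ hΨ
  have hT := tsupport_truncBerg hα hf hint ht hΨ0
  have hc : HasCompactSupport (truncBerg α f Ψ) :=
    (isCompact_le_uBerg hα hf hint ht).of_isClosed_subset (isClosed_tsupport _) hT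
  set h := truncBerg α f Ψ with hhdef
  set hC : ℂ → ℂ := fun z => (h z : ℂ) with hhC
  have hCd : ContDiff ℝ 1 hC := Complex.ofRealCLM.contDiff.comp hh
  have htC : tsupport hC = tsupport h := by
    unfold tsupport
    congr 1
    ext z; simp [hhC]
  have hCc : HasCompactSupport hC := by rw [HasCompactSupport, htC]; exact hc
  have hGs : Function.support (wbar hC) ⊆ tsupport h := htC ▸ support_wbar_subset hC
  have hU : tsupport h ⊆ Metric.ball 0 1 := fun z hz => (hT hz).1
  have hfa : ∀ z ∈ tsupport h, AnalyticAt ℂ (fun w => deriv f w / f w) z := fun z hz => by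
    have h1 := hf.analyticAt (Metric.isOpen_ball.mem_nhds (hU hz))
    exact h1.deriv.div h1 (ne_zero_of_le_uBerg ht (hT hz).2)
  set q' : ℂ → (ℂ →L[ℝ] ℂ) := fun z => deriv (fun w => deriv f w / f w) z •
    ContinuousLinearMap.id ℝ ℂ - (α : ℂ) • fderivConjDiv z with hq'
  have hqd : ∀ z ∈ tsupport h, HasFDerivAt (logDerivBerg α f) (q' z) z := fun z hz => by
    have h1 := (hfa z hz).differentiableAt.hasDerivAt.hasFDerivAt.restrictScalars ℝ
    have h2 := (hasFDerivAt_conj_div (by simpa using hU hz)).const_mul (α : ℂ)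
    refine (h1.sub h2).congr_fderiv ?_
    ext v
    simp [hq', mul_comm]
  have hqc : ContinuousOn q' (tsupport h) := by
    have h1 : ContinuousOn (deriv fun w => deriv f w / f w) (tsupport h) :=
      fun z hz => (hfa z hz).deriv.continuousAt.continuousWithinAt
    exact (h1.smul continuousOn_const).sub
      ((continuousOn_fderivConjDiv.mono hU).const_smul (α : ℂ))
  have hqcont : ContinuousOn (logDerivBerg α f) (tsupport h) :=
    fun z hz => (hqd z hz).continuousAt.continuousWithinAt
  have hmain := integral_wbar_mul hCd hCc (htC ▸ hqd) (htC ▸ hqc)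
    (p := fun z => -(2 * α) * hypDensity z) (fun z _ => by
      simp only [hq', _root_.sub_apply, _root_.smul_apply, ContinuousLinearMap.id_apply, smul_eq_mul]
      linear_combination (-(α : ℂ)) * fderivConjDiv_wbar z +
        deriv (fun w => deriv f w / f w) z * Complex.I_sq)
  have e : ∀ z, wbar hC z * logDerivBerg α f z = ((‖wbar hC z‖ * ‖logDerivBerg α f z‖ : ℝ) : ℂ) := by
    intro z
    by_cases hz : wbar hC z = 0
    · simp [hz]
    · have hz' := hGs hz
      have hu : 0 ≤ ψ (uBerg α f z) * uBerg α f z := mul_nonneg (hψ0 _) (ht.le.trans (hT hz').2)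
      rw [hhC, wbar_truncBerg hα hf hint ht hΨ0 hΨ hz', norm_mul, RCLike.norm_conj,
        Complex.norm_real, Real.norm_of_nonneg hu, mul_assoc, mul_assoc, ← sq, mul_comm,
        Complex.conj_mul']
      push_cast
      ring
  have hint2 : Integrable fun z => wbar hC z * logDerivBerg α f z :=
    integrable_mul_of_support_subset hc (continuous_wbar hCd) hGs hqcont
  refine ⟨?_, ?_⟩
  · simpa only [norm_mul] using hint2.norm
  · simp only [e] at hmain
    have e2 : ∀ z, hC z * (-(2 * α) * hypDensity z) = ((-(2 * α) * (h z * hypDensity z) : ℝ) : ℂ) :=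
      fun z => by simp only [hhC]; push_cast; ring
    simp only [e2, integral_complex_ofReal, integral_const_mul] at hmain
    have := Complex.ofReal_injective (hmain.trans (Complex.ofReal_neg _).symm)
    rw [this]; ring

lemma muBerg_ineq_aux {η : ℝ} (hα : 0 < α) (hf : DifferentiableOn ℂ f (Metric.ball (0 : ℂ) 1))
    (hint : IntegrableOn (fun z : ℂ => ‖f z‖ ^ 2 * (1 - ‖z‖ ^ 2) ^ (α - 2))
      (Metric.ball (0 : ℂ) 1)) (ht : 0 < t) (hs : (superBerg α f s).Nonempty)
    (hη : 0 < η) (hts : 2 * η < s - t) :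
    2 / α * (s - t - 2 * η) * (muBerg α f s * (1 + muBerg α f s)) ≤
      s * muBerg α f t * (muBerg α f t - muBerg α f s) := by
  obtain ⟨ψ, Ψ, hψ, hΨ, hψ0, hψ1, hψt, hψs, hΨ0, hΨ1, hΨ01⟩ := exists_cutoff hη hts
  have hts' : t ≤ s := by linarith
  have hs0 : 0 < s := by linarith
  have hMs := muBerg_pos hα hf hint hs0 hs
  have hMt := muBerg_pos hα hf hint ht (hs.mono (superBerg_anti α f hts'))
  have hh := contDiff_truncBerg hα hf hint ht hΨ0 hψ hΨ
  have hT := tsupport_truncBerg hα hf hint ht hΨ0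
  have hc : HasCompactSupport (truncBerg α f Ψ) :=
    (isCompact_le_uBerg hα hf hint ht).of_isClosed_subset (isClosed_tsupport _) hT
  have hmeas : ∀ κ, MeasurableSet (superBerg α f κ) :=
    fun κ => (isOpen_superBerg α hf.continuousOn κ).measurableSet
  have hiso := isoperimetric hh hc (fun z hz => (hT hz).1)
    (fun z => Set.indicator_nonneg (fun z _ => (hΨ01 _).1) z) (hmeas s)
    (fun z hz => by rw [truncBerg, Set.indicator_of_mem hz.1, hΨ1 _ hz.2.le])
    (setIntegral_superBerg α f s) hMs
  obtain ⟨hAi, hA⟩ := integral_wbar_truncBerg hα hf hint ht hΨ0 hψ hΨ hψ0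
  have hit := integrableOn_superBerg hα hf hint ht
  have his := integrableOn_superBerg hα hf hint hs0
  set Mt := muBerg α f t
  set Ms := muBerg α f s
  set G := wbar fun z => (truncBerg α f Ψ z : ℂ) with hG
  have hGT : ∀ z, G z ≠ 0 → z ∈ tsupport (truncBerg α f Ψ) := fun z hz => by
    have := support_wbar_subset (fun z => (truncBerg α f Ψ z : ℂ)) hz
    refine closure_mono (fun w hw => ?_) this
    simpa using hw
  have hH : ∫ z, truncBerg α f Ψ z * hypDensity z ≤ Real.pi * Mt := by
    rw [← setIntegral_superBerg, ← integral_indicator (hmeas t)]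
    refine integral_mono_of_nonneg (ae_of_all _ fun z => mul_nonneg
      (Set.indicator_nonneg (fun z _ => (hΨ01 _).1) z) (hypDensity_nonneg z))
      ((integrable_indicator_iff (hmeas t)).2 hit) (ae_of_all _ fun z => ?_)
    by_cases hz : z ∈ superBerg α f t
    · simp only [truncBerg, Set.indicator_of_mem hz, Set.indicator_of_mem hz.1]
      exact mul_le_of_le_one_left (hypDensity_nonneg z) (hΨ01 _).2
    · have : truncBerg α f Ψ z = 0 := by
        by_cases hz1 : z ∈ Metric.ball (0 : ℂ) 1
        · rw [truncBerg, Set.indicator_of_mem hz1, hΨ0]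
          by_contra! hlt
          exact hz ⟨hz1, hlt⟩
        · exact Set.indicator_of_notMem hz1 _
      simp [this, Set.indicator_of_notMem hz]
  have hA' : ∫ z, ‖G z‖ * ‖logDerivBerg α f z‖ ≤ 2 * α * (Real.pi * Mt) := by
    rw [hA]; gcongr
  set c := (s - t - 2 * η)⁻¹ with hcdef
  have hc0 : 0 < c := inv_pos.2 (by linarith)
  set b : ℂ → ℝ := (superBerg α f t \ superBerg α f s).indicator fun z => c * s * hypDensity z with hb
  have hbi : Integrable b := (integrable_indicator_iff ((hmeas t).diff (hmeas s))).2
    ((hit.mono_set Set.sdiff_subset).const_mul _)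
  have hbB : ∫ z, b z = c * s * (Real.pi * (Mt - Ms)) := by
    rw [hb, integral_indicator ((hmeas t).diff (hmeas s)), integral_const_mul,
      setIntegral_sdiff (hmeas s) hit (superBerg_anti α f hts'), setIntegral_superBerg,
      setIntegral_superBerg]
    ring
  have hb0 : ∀ z, 0 ≤ b z := fun z => Set.indicator_nonneg
    (fun z _ => mul_nonneg (by positivity) (hypDensity_nonneg z)) z
  have hpt : ∀ l : ℝ, 0 < l → ∀ z, 2 * (‖G z‖ * (1 - ‖z‖ ^ 2)⁻¹) ≤
      l * (‖G z‖ * ‖logDerivBerg α f z‖) + l⁻¹ * b z := by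
    intro l hl z
    by_cases hz : G z = 0
    · simp only [hz, norm_zero, zero_mul, mul_zero, zero_add]
      exact mul_nonneg (inv_nonneg.2 hl.le) (hb0 z)
    have hzT := hGT z hz
    have hz1 := (hT hzT).1
    have hGz := wbar_truncBerg hα hf hint ht hΨ0 hΨ hzT
    rw [← hG] at hGz
    have hψz : ψ (uBerg α f z) ≠ 0 := fun h0 => hz (by rw [hGz, h0]; simp)
    have hut : t < uBerg α f z := by
      by_contra! h; exact hψz (hψt _ h)
    have hus : uBerg α f z < s := by
      by_contra! h; exact hψz (hψs _ h)
    have hbz : b z = c * s * hypDensity z :=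
      Set.indicator_of_mem (show z ∈ superBerg α f t \ superBerg α f s from
        ⟨⟨hz1, hut⟩, fun h => lt_asymm hus h.2⟩) _
    have hu : 0 ≤ ψ (uBerg α f z) * uBerg α f z := mul_nonneg (hψ0 _) (ht.trans hut).le
    have hle : ψ (uBerg α f z) * uBerg α f z ≤ c * s :=
      mul_le_mul (hψ1 _) hus.le (ht.trans hut).le hc0.le
    rw [hbz, hGz, norm_mul, RCLike.norm_conj, Complex.norm_real, Real.norm_of_nonneg hu]
    set v := ψ (uBerg α f z) * uBerg α f z
    set Q := ‖logDerivBerg α f z‖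
    have hyp : hypDensity z = ((1 - ‖z‖ ^ 2)⁻¹) ^ 2 := by rw [hypDensity, inv_pow]
    set ρ := (1 - ‖z‖ ^ 2)⁻¹
    have h1 : 2 * (v * Q * ρ) ≤ l * (v * Q * Q) + l⁻¹ * (v * ρ ^ 2) := by
      have : l * (v * Q * Q) + l⁻¹ * (v * ρ ^ 2) - 2 * (v * Q * ρ) = v * l⁻¹ * (l * Q - ρ) ^ 2 := by
        field_simp; ring
      have : 0 ≤ v * l⁻¹ * (l * Q - ρ) ^ 2 := by positivity
      linarith
    refine h1.trans ?_
    rw [hyp]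
    gcongr
  have hint2 : ∀ l : ℝ, 0 < l → 2 * (2 * Real.pi * √(Ms * (Ms + 1))) ≤
      l * (2 * α * (Real.pi * Mt)) + l⁻¹ * (c * s * (Real.pi * (Mt - Ms))) := by
    intro l hl
    calc 2 * (2 * Real.pi * √(Ms * (Ms + 1))) ≤ 2 * ∫ y, ‖G y‖ * (1 - ‖y‖ ^ 2)⁻¹ := by gcongr
      _ = ∫ y, 2 * (‖G y‖ * (1 - ‖y‖ ^ 2)⁻¹) := (integral_const_mul _ _).symm
      _ ≤ ∫ z, (l * (‖G z‖ * ‖logDerivBerg α f z‖) + l⁻¹ * b z) := by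
          refine integral_mono_of_nonneg (ae_of_all _ fun z => ?_)
            ((hAi.const_mul l).add (hbi.const_mul _)) (ae_of_all _ (hpt l hl))
          by_cases hz : G z = 0
          · simp [hz]
          · have : ‖z‖ < 1 := by simpa using (hT (hGT z hz)).1
            have : 0 < 1 - ‖z‖ ^ 2 := by nlinarith [norm_nonneg z]
            simp only [Pi.zero_apply]; positivity
      _ = l * (∫ z, ‖G z‖ * ‖logDerivBerg α f z‖) + l⁻¹ * ∫ z, b z := by
          rw [integral_add (hAi.const_mul l) (hbi.const_mul _), integral_const_mul,
            integral_const_mul]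
      _ ≤ _ := by rw [hbB]; gcongr
  have hpi := Real.pi_pos
  set X := 2 * Real.pi * √(Ms * (Ms + 1)) with hX
  have hX0 : 0 < X := by positivity
  have hX2 : X ^ 2 = 4 * Real.pi ^ 2 * (Ms * (Ms + 1)) := by
    rw [hX, mul_pow, Real.sq_sqrt (by positivity)]; ring
  have hfin := hint2 (X / (2 * α * (Real.pi * Mt))) (by positivity)
  rw [div_mul_cancel₀ _ (by positivity), inv_div, div_mul_eq_mul_div] at hfin
  have hfin2 : X ≤ 2 * α * (Real.pi * Mt) * (c * s * (Real.pi * (Mt - Ms))) / X := by linarith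
  rw [le_div_iff₀ hX0, ← sq, hX2] at hfin2
  have hne : s - t - 2 * η ≠ 0 := by linarith
  have hk : 0 < 2 * α * Real.pi ^ 2 * c := by positivity
  refine le_of_mul_le_mul_left ?_ hk
  have e1 : c * (s - t - 2 * η) = 1 := inv_mul_cancel₀ hne
  have e2 : 2 * α * Real.pi ^ 2 * c * (2 / α * (s - t - 2 * η) * (Ms * (1 + Ms))) =
      4 * Real.pi ^ 2 * (Ms * (Ms + 1)) * (c * (s - t - 2 * η)) := by
    field_simp; ring
  rw [e2, e1]
  linarith

lemma muBerg_ineq (hα : 0 < α) (hf : DifferentiableOn ℂ f (Metric.ball (0 : ℂ) 1))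
    (hint : IntegrableOn (fun z : ℂ => ‖f z‖ ^ 2 * (1 - ‖z‖ ^ 2) ^ (α - 2))
      (Metric.ball (0 : ℂ) 1)) (ht : 0 < t) (hts : t < s) (hs : (superBerg α f s).Nonempty) :
    2 / α * (s - t) * (muBerg α f s * (1 + muBerg α f s)) ≤
      s * muBerg α f t * (muBerg α f t - muBerg α f s) := by
  refine le_of_tendsto (x := nhdsWithin 0 (Set.Ioi 0)) (f := fun η : ℝ =>
    2 / α * (s - t - 2 * η) * (muBerg α f s * (1 + muBerg α f s))) ?_ ?_
  · have : Continuous fun η : ℝ =>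
      2 / α * (s - t - 2 * η) * (muBerg α f s * (1 + muBerg α f s)) := by fun_prop
    simpa using (this.tendsto 0).mono_left nhdsWithin_le_nhds
  · filter_upwards [Ioo_mem_nhdsGT (show 0 < (s - t) / 2 by linarith)] with η hη
    exact muBerg_ineq_aux hα hf hint ht hs hη.1 (by linarith [hη.2])

end

lemma log_step {x y ε : ℝ} (hx : 0 < x) (hy : 0 < y) (hε : 0 ≤ ε)
    (h : ε * (y * (1 + y)) ≤ x * (x - y)) :
    ε - ε * (Real.log x - Real.log y) - ε ^ 2 ≤ Real.log (1 + x) - Real.log (1 + y) := by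
  have hyx : y ≤ x := by
    by_contra! hlt
    have : 0 ≤ ε * (y * (1 + y)) := by positivity
    nlinarith
  set w := ε * (y / x) with hw
  have hw0 : 0 ≤ w := by positivity
  have hwε : w ≤ ε := mul_le_of_le_one_right hε ((div_le_one hx).2 hyx)
  have h1 : 1 + w ≤ (1 + x) / (1 + y) := by
    rw [le_div_iff₀ (by positivity), hw]
    have : ε * (y / x) * (1 + y) ≤ x - y := by
      rw [← mul_div_assoc, div_mul_eq_mul_div, div_le_iff₀ hx]
      linarith
    linarith
  have h2 : Real.log (1 + w) ≤ Real.log (1 + x) - Real.log (1 + y) := by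
    rw [← Real.log_div (by positivity) (by positivity)]
    exact Real.log_le_log (by positivity) h1
  have h3 : w - w ^ 2 ≤ Real.log (1 + w) := by
    refine le_trans ?_ (Real.one_sub_inv_le_log_of_pos (by positivity))
    have : 1 - (1 + w)⁻¹ = w / (1 + w) := by field_simp; ring
    rw [this, le_div_iff₀ (by positivity)]
    nlinarith [pow_nonneg hw0 3]
  have h4 : 1 - (Real.log x - Real.log y) ≤ y / x := by
    have := Real.log_le_sub_one_of_pos (div_pos hy hx)
    rw [Real.log_div hy.ne' hx.ne'] at this
    linarith
  have h5 : ε * (1 - (Real.log x - Real.log y)) ≤ w := mul_le_mul_of_nonneg_left h4 hε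
  have h6 : w ^ 2 ≤ ε ^ 2 := by gcongr
  linarith

/-- A discrete differential inequality integrates to monotonicity of `κ ^ β * (1 + M κ)`. -/
lemma rpow_mul_anti_of_ineq {M : ℝ → ℝ} {β t s : ℝ} (hβ : 0 < β) (ht : 0 < t) (hts : t < s)
    (hpos : ∀ a, t ≤ a → a ≤ s → 0 < M a)
    (h : ∀ a b, t ≤ a → a < b → b ≤ s →
      β * (b - a) * (M b * (1 + M b)) ≤ b * M a * (M a - M b)) :
    s ^ β * (1 + M s) ≤ t ^ β * (1 + M t) := by
  have hs : 0 < s := ht.trans hts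
  set L := Real.log (s / t) with hL
  have hL0 : 0 < L := Real.log_pos (by rwa [one_lt_div ht])
  set D := Real.log (M t) - Real.log (M s)
  have key : ∀ n : ℕ, 0 < n → ∀ ε, ε = β * L / (n + L) →
      n * ε - ε * D - n * ε ^ 2 ≤ Real.log (1 + M t) - Real.log (1 + M s) := by
    intro n hn ε hε
    have hn' : (0 : ℝ) < n := Nat.cast_pos.2 hn
    have hε0 : 0 < ε := by rw [hε]; positivity
    set κ : ℕ → ℝ := fun i => t * Real.exp (i * (L / n)) with hκ
    have hκ0 : κ 0 = t := by simp [hκ]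
    have hκn : κ n = s := by
      simp only [hκ]
      rw [mul_div_cancel₀ _ hn'.ne', hL, Real.exp_log (by positivity), mul_div_cancel₀ _ ht.ne']
    have hκm : StrictMono κ := fun i j hij => by
      simp only [hκ]
      have : (i : ℝ) < j := Nat.cast_lt.2 hij
      gcongr
    have hind : ∀ k ≤ n, k * ε - ε * (Real.log (M t) - Real.log (M (κ k))) - k * ε ^ 2 ≤
        Real.log (1 + M t) - Real.log (1 + M (κ k)) := by
      intro k
      induction k with
      | zero => intro _; simp [hκ0]
      | succ k ih =>
        intro hk
        have h1 := ih (by omega)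
        have ha : t ≤ κ k := hκ0 ▸ hκm.monotone (Nat.zero_le k)
        have hb : κ (k + 1) ≤ s := hκn ▸ hκm.monotone hk
        have hab : κ k < κ (k + 1) := hκm (Nat.lt_succ_self k)
        have hM1 := hpos _ ha (hab.le.trans hb)
        have hM2 := hpos _ (ha.trans hab.le) hb
        have hκp : 0 < κ (k + 1) := ht.trans_le (ha.trans hab.le)
        have hrat : ε * κ (k + 1) ≤ β * (κ (k + 1) - κ k) := by
          have e1 : κ (k + 1) = κ k * Real.exp (L / n) := by
            simp only [hκ]
            rw [mul_assoc, ← Real.exp_add]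
            congr 2; push_cast; ring
          have e2 : L / n + 1 ≤ Real.exp (L / n) := Real.add_one_le_exp _
          have hκk : 0 < κ k := ht.trans_le ha
          rw [e1, hε]
          have e3 : (n + L) ≤ n * Real.exp (L / n) := by
            calc n + L = n * (L / n + 1) := by field_simp; ring
              _ ≤ _ := by gcongr
          rw [div_mul_eq_mul_div, div_le_iff₀ (by positivity)]
          have : 0 ≤ β * κ k * (n * Real.exp (L / n) - (n + L)) := by
            have := sub_nonneg.2 e3
            positivity
          nlinarith
        have h2 := log_step hM1 hM2 hε0.le (by
          have h3 := h _ _ ha hab hb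
          have h4 : ε * κ (k + 1) * (M (κ (k + 1)) * (1 + M (κ (k + 1)))) ≤
              β * (κ (k + 1) - κ k) * (M (κ (k + 1)) * (1 + M (κ (k + 1)))) := by gcongr
          refine le_of_mul_le_mul_left ?_ hκp
          linarith)
        push_cast
        linarith
    have := hind n le_rfl
    rwa [hκn] at this
  have hlim : Filter.Tendsto (fun n : ℕ => (n : ℝ) * (β * L / (n + L)) - (β * L / (n + L)) * D -
      n * (β * L / (n + L)) ^ 2) Filter.atTop (nhds (β * L)) := by
    have h1 : Filter.Tendsto (fun n : ℕ => (n : ℝ) / (n + L)) Filter.atTop (nhds 1) :=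
      tendsto_natCast_div_add_atTop L
    have h2 : Filter.Tendsto (fun n : ℕ => β * L / ((n : ℝ) + L)) Filter.atTop (nhds 0) :=
      Filter.Tendsto.const_div_atTop
        (Filter.tendsto_atTop_add_const_right _ _ tendsto_natCast_atTop_atTop) _
    have h3 := ((h1.const_mul (β * L)).sub (h2.mul_const D)).sub
      ((h1.const_mul (β * L)).mul h2)
    simp only [mul_one, zero_mul, mul_zero, sub_zero] at h3
    refine h3.congr fun n => ?_
    ring
  have hfin : β * L ≤ Real.log (1 + M t) - Real.log (1 + M s) := by
    refine le_of_tendsto hlim ?_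
    filter_upwards [Filter.eventually_gt_atTop 0] with n hn
    exact key n hn _ rfl
  have hMt := hpos t le_rfl hts.le
  have hMs := hpos s hts.le le_rfl
  rw [hL, Real.log_div hs.ne' ht.ne'] at hfin
  refine (Real.log_le_log_iff (by positivity) (by positivity)).1 ?_
  rw [Real.log_mul (by positivity) (by positivity), Real.log_mul (by positivity) (by positivity),
    Real.log_rpow hs, Real.log_rpow ht]
  linarith

lemma setIntegral_hypDensity_norm_gt {R : ℝ} (hR : 1 < R) :
    ∫ w in {w : ℂ | R < ‖w‖}, hypDensity w = Real.pi / (R ^ 2 - 1) := by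
  have h := integral_fun_norm_addHaar (E := ℂ) volume
    ((Set.Ioi R).indicator fun r => ((1 - r ^ 2) ^ 2)⁻¹)
  have hm : MeasurableSet {w : ℂ | R < ‖w‖} := (isOpen_lt continuous_const continuous_norm).measurableSet
  have e : (fun z : ℂ => (Set.Ioi R).indicator (fun r => ((1 - r ^ 2) ^ 2)⁻¹) ‖z‖) =
      {w : ℂ | R < ‖w‖}.indicator hypDensity := by
    ext z
    by_cases hz : R < ‖z‖
    · rw [Set.indicator_of_mem (by simpa using hz), Set.indicator_of_mem (by simpa using hz)]
      rfl
    · rw [Set.indicator_of_notMem (by simpa using hz), Set.indicator_of_notMem (by simpa using hz)]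
  rw [e, integral_indicator hm, Complex.finrank_real_complex] at h
  rw [h]
  have h2 : ∫ y in Set.Ioi (0 : ℝ), y ^ (2 - 1) • (Set.Ioi R).indicator (fun r => ((1 - r ^ 2) ^ 2)⁻¹) y =
      ∫ y in Set.Ioi R, y * ((1 - y ^ 2) ^ 2)⁻¹ := by
    have : (fun y : ℝ => y ^ (2 - 1) • (Set.Ioi R).indicator (fun r => ((1 - r ^ 2) ^ 2)⁻¹) y) =
        (Set.Ioi R).indicator fun y => y * ((1 - y ^ 2) ^ 2)⁻¹ := by
      ext y
      by_cases hy : y ∈ Set.Ioi R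
      · simp only [Set.indicator_of_mem hy]; simp
      · simp [Set.indicator_of_notMem hy]
    rw [this, setIntegral_indicator measurableSet_Ioi, Set.inter_eq_right.2]
    exact Set.Ioi_subset_Ioi (by linarith)
  rw [h2]
  have h3 : ∫ y in Set.Ioi R, y * ((1 - y ^ 2) ^ 2)⁻¹ = 0 - (-(1 / 2) * (R ^ 2 - 1)⁻¹) := by
    refine integral_Ioi_of_hasDerivAt_of_nonneg' (g := fun y => -(1 / 2) * (y ^ 2 - 1)⁻¹)
      (fun y hy => ?_) (fun y hy => ?_) ?_
    · have hy : R ≤ y := hy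
      have h' : 1 - y ^ 2 ≠ 0 := by nlinarith
      have : y ^ 2 - 1 ≠ 0 := by nlinarith
      refine ((((hasDerivAt_pow 2 y).sub_const 1).inv this).const_mul (-(1 / 2) : ℝ)).congr_deriv ?_
      field_simp
      ring
    · have hy : R < y := hy
      have : 0 < y := by linarith
      positivity
    · have : Filter.Tendsto (fun y : ℝ => y ^ 2 - 1) Filter.atTop Filter.atTop :=
        Filter.tendsto_atTop_add_const_right _ _ (Filter.tendsto_pow_atTop two_ne_zero)
      simpa using this.inv_tendsto_atTop.const_mul (-(1 / 2) : ℝ)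
  rw [h3]
  have : R ^ 2 - 1 ≠ 0 := by nlinarith
  simp [Measure.real, Complex.volume_ball]
  field_simp

lemma one_sub_conj_mul_ne_zero {w z : ℂ} (hw : ‖w‖ < 1) (hz : ‖z‖ < 1) :
    1 - (starRingEnd ℂ) w * z ≠ 0 := by
  intro h
  have h1 := one_sub_conj_mul_normSq w z
  rw [h, norm_zero] at h1
  have hw2 : 0 < 1 - ‖w‖ ^ 2 := by nlinarith [norm_nonneg w]
  have hz2 : 0 < 1 - ‖z‖ ^ 2 := by nlinarith [norm_nonneg z]
  nlinarith [mul_pos hz2 hw2, sq_nonneg ‖z - w‖]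

lemma uBerg_of_optimizer {α θ : ℝ} {f : ℂ → ℂ} {w z : ℂ} (hw : ‖w‖ < 1) (hz : ‖z‖ < 1)
    (hf : f z = Complex.exp (Complex.I * (θ : ℂ)) * ((((1 - ‖w‖ ^ 2) ^ (α / 2) : ℝ)) : ℂ) *
      (1 - (starRingEnd ℂ) w * z) ^ (-(α : ℂ))) :
    uBerg α f z =
      ((1 - ‖z‖ ^ 2) * (1 - ‖w‖ ^ 2) / ‖1 - (starRingEnd ℂ) w * z‖ ^ 2) ^ (α / 2) := by
  have hw2 : 0 < 1 - ‖w‖ ^ 2 := by nlinarith [norm_nonneg w]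
  have hz2 : 0 < 1 - ‖z‖ ^ 2 := by nlinarith [norm_nonneg z]
  have hp : 0 < ‖1 - (starRingEnd ℂ) w * z‖ := norm_pos_iff.2 (one_sub_conj_mul_ne_zero hw hz)
  rw [uBerg, hf, ← Complex.ofReal_neg, norm_mul, norm_mul, Complex.norm_cpow_real,
    mul_comm Complex.I, Complex.norm_exp_ofReal_mul_I, Complex.norm_real,
    Real.norm_of_nonneg (by positivity), Real.div_rpow (by positivity) (by positivity),
    Real.mul_rpow hz2.le hw2.le, ← Real.rpow_natCast_mul hp.le, Real.rpow_neg hp.le]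
  have : ((2 : ℕ) : ℝ) * (α / 2) = α := by push_cast; ring
  rw [this]
  ring

lemma uBerg_optimizer_le_one {α : ℝ} (hα : 0 < α) {f : ℂ → ℂ} (hf : f ∈ bergOpt α) {z : ℂ}
    (hz : ‖z‖ < 1) : uBerg α f z ≤ 1 := by
  obtain ⟨w, θ, hw, hf⟩ := hf
  rw [uBerg_of_optimizer hw hz (hf z (by simpa using hz))]
  have hw2 : 0 < 1 - ‖w‖ ^ 2 := by nlinarith [norm_nonneg w]
  have hz2 : 0 < 1 - ‖z‖ ^ 2 := by nlinarith [norm_nonneg z]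
  have hp : 0 < ‖1 - (starRingEnd ℂ) w * z‖ := norm_pos_iff.2 (one_sub_conj_mul_ne_zero hw hz)
  refine Real.rpow_le_one (by positivity) ?_ (by positivity)
  rw [div_le_one (by positivity), one_sub_conj_mul_normSq]
  nlinarith [sq_nonneg ‖z - w‖]

lemma lt_uBerg_optimizer_iff {α κ R : ℝ} (hα : 0 < α) (hκ : 0 < κ) (hR : 0 < R)
    (hRκ : R ^ 2 * (1 - κ ^ (2 / α)) = 1) {f : ℂ → ℂ} {w z : ℂ} (hw : ‖w‖ < 1)
    (hz : ‖z‖ < 1) (hzw : z ≠ w)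
    (hf : uBerg α f z =
      ((1 - ‖z‖ ^ 2) * (1 - ‖w‖ ^ 2) / ‖1 - (starRingEnd ℂ) w * z‖ ^ 2) ^ (α / 2)) :
    κ < uBerg α f z ↔ R < ‖invMob 1 w z‖ := by
  have hw2 : 0 < 1 - ‖w‖ ^ 2 := by nlinarith [norm_nonneg w]
  have hz2 : 0 < 1 - ‖z‖ ^ 2 := by nlinarith [norm_nonneg z]
  have hp : 0 < ‖1 - (starRingEnd ℂ) w * z‖ := norm_pos_iff.2 (one_sub_conj_mul_ne_zero hw hz)
  have hd : 0 < ‖z - w‖ := norm_pos_iff.2 (sub_ne_zero.2 hzw)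
  have h1 := one_sub_conj_mul_normSq w z
  set τ := κ ^ (2 / α) with hτ
  have hκτ : κ = τ ^ (α / 2) := by
    rw [hτ, ← Real.rpow_mul hκ.le, show 2 / α * (α / 2) = 1 by field_simp, Real.rpow_one]
  have hτ0 : 0 < τ := Real.rpow_pos_of_pos hκ _
  have hτ1 : 0 < 1 - τ := by
    by_contra hcon
    nlinarith [mul_nonneg (sq_nonneg R) (neg_nonneg.2 (not_lt.1 hcon))]
  rw [hf, hκτ, Real.rpow_lt_rpow_iff hτ0.le (by positivity) (by positivity),
    lt_div_iff₀ (by positivity), ← sq_lt_sq₀ hR.le (norm_nonneg _), invMob, norm_div, norm_mul,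
    norm_one, one_mul, div_pow, lt_div_iff₀ (by positivity),
    ← mul_lt_mul_iff_of_pos_right (b := R ^ 2 * ‖z - w‖ ^ 2) hτ1,
    show R ^ 2 * ‖z - w‖ ^ 2 * (1 - τ) = ‖z - w‖ ^ 2 * (R ^ 2 * (1 - τ)) by ring, hRκ]
  constructor <;> intro h <;> nlinarith

lemma muBerg_optimizer {α κ : ℝ} (hα : 0 < α) (hκ : 0 < κ) (hκ1 : κ < 1) {f : ℂ → ℂ}
    (hf : f ∈ bergOpt α) : κ ^ (2 / α) * (1 + muBerg α f κ) = 1 := by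
  obtain ⟨w, θ, hw, hf⟩ := hf
  set τ := κ ^ (2 / α) with hτ
  have hτ0 : 0 < τ := Real.rpow_pos_of_pos hκ _
  have hτ1 : τ < 1 := Real.rpow_lt_one hκ.le hκ1 (by positivity)
  obtain ⟨R, hR, hR2⟩ : ∃ R : ℝ, 0 < R ∧ R ^ 2 = (1 - τ)⁻¹ :=
    ⟨√(1 - τ)⁻¹, Real.sqrt_pos.2 (inv_pos.2 (by linarith)),
      Real.sq_sqrt (inv_nonneg.2 (by linarith))⟩
  have hRτ : R ^ 2 * (1 - τ) = 1 := by rw [hR2]; field_simp [(by linarith : 1 - τ ≠ 0)]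
  have hR1 : 1 < R := by
    rw [← one_lt_sq_iff₀ hR.le, hR2]
    exact (one_lt_inv₀ (by linarith)).2 (by linarith)
  have hu : ∀ z ∈ Metric.ball (0 : ℂ) 1, z ≠ w → (κ < uBerg α f z ↔ R < ‖invMob 1 w z‖) := by
    intro z hz hzw
    have hz' : ‖z‖ < 1 := by simpa using hz
    exact lt_uBerg_optimizer_iff hα hκ hR hRτ hw hz' hzw (uBerg_of_optimizer hw hz' (hf z hz))
  have hm : MeasurableSet {v : ℂ | R < ‖v‖} :=
    (isOpen_lt continuous_const continuous_norm).measurableSet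
  have hinv : Measurable (invMob 1 w) := by unfold invMob; fun_prop
  have hm' : MeasurableSet {z : ℂ | R < ‖invMob 1 w z‖} := hinv hm
  have key : ∫ z in superBerg α f κ, hypDensity z = ∫ v in {v : ℂ | R < ‖v‖}, hypDensity v := by
    have hset : superBerg α f κ =ᵐ[volume] (Metric.ball 0 1 ∩ {z | R < ‖invMob 1 w z‖} : Set ℂ) := by
      filter_upwards [compl_mem_ae_iff.2 (measure_singleton (μ := volume) w)] with z hz
      exact propext (and_congr_right fun h => hu z h hz)
    rw [setIntegral_congr_set hset, integral_eq_lintegral_of_nonneg_ae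
        (Filter.Eventually.of_forall hypDensity_nonneg)
        measurable_hypDensity.aestronglyMeasurable,
      integral_eq_lintegral_of_nonneg_ae (Filter.Eventually.of_forall hypDensity_nonneg)
        measurable_hypDensity.aestronglyMeasurable]
    congr 1
    have h := lintegral_invMob (ζ := 1) norm_one hw ({v : ℂ | R < ‖v‖}.indicator 1)
    have e1 : (fun x => ENNReal.ofReal (hypDensity x) *
        {v : ℂ | R < ‖v‖}.indicator (1 : ℂ → ENNReal) (invMob 1 w x)) =
        {z | R < ‖invMob 1 w z‖}.indicator fun x => ENNReal.ofReal (hypDensity x) := by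
      ext x
      simp [Set.indicator_apply]
    have e2 : (fun x => ENNReal.ofReal (hypDensity x) *
        {v : ℂ | R < ‖v‖}.indicator (1 : ℂ → ENNReal) x) =
        {v : ℂ | R < ‖v‖}.indicator fun x => ENNReal.ofReal (hypDensity x) := by
      ext x
      simp [Set.indicator_apply]
    rw [e1, e2, setLIntegral_indicator hm', setLIntegral_indicator hm, Set.inter_comm,
      show {v : ℂ | R < ‖v‖} ∩ {v | 1 < ‖v‖} = {v | R < ‖v‖} from
        Set.inter_eq_left.2 fun v hv => hR1.trans hv] at h
    exact h
  rw [setIntegral_superBerg, setIntegral_hypDensity_norm_gt hR1] at key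
  have hne : R ^ 2 - 1 ≠ 0 := by nlinarith
  have hmu : muBerg α f κ = (R ^ 2 - 1)⁻¹ := by
    have := Real.pi_ne_zero
    field_simp at key ⊢
    linarith
  rw [hmu]
  field_simp
  nlinarith

/-- **Lemma 2.3 (monotonicity lemma), Case 3.** For `α > 1` and `f ∈ A²_α(𝔻)`, the
function `κ ↦ κ^{2/α} (−1 − μ(κ))` is nondecreasing on `(0, sup u_f)`; if `f ∈ M₃` it is
constant there. -/
theorem mono_bergman (α : ℝ) (hα : 1 < α) (f : ℂ → ℂ)
    (hf : DifferentiableOn ℂ f (Metric.ball (0:ℂ) 1))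
    (hint : IntegrableOn (fun z : ℂ => ‖f z‖^2 * (1 - ‖z‖^2) ^ (α-2))
      (Metric.ball (0:ℂ) 1)) :
    MonotoneOn (fun κ : ℝ => κ ^ (2/α) * (-1 - muBerg α f κ))
      (Set.Ioo 0 (⨆ z : Metric.ball (0:ℂ) 1, uBerg α f z)) ∧
    (f ∈ bergOpt α →
      ∀ κ₁ ∈ Set.Ioo 0 (⨆ z : Metric.ball (0:ℂ) 1, uBerg α f z),
      ∀ κ₂ ∈ Set.Ioo 0 (⨆ z : Metric.ball (0:ℂ) 1, uBerg α f z),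
        κ₁ ^ (2/α) * (-1 - muBerg α f κ₁) = κ₂ ^ (2/α) * (-1 - muBerg α f κ₂)) := by
  have hα0 : 0 < α := by linarith
  constructor
  · intro a ha b hb hab
    rcases hab.eq_or_lt with rfl | hlt
    · exact le_rfl
    have : Nonempty (Metric.ball (0 : ℂ) 1) := ⟨⟨0, by simp⟩⟩
    obtain ⟨z, hz⟩ := exists_lt_of_lt_ciSup hb.2
    have hne : ∀ κ ≤ b, (superBerg α f κ).Nonempty := fun κ hκ =>
      ⟨z, z.2, hκ.trans_lt hz⟩
    have h := rpow_mul_anti_of_ineq (M := muBerg α f) (div_pos two_pos hα0) ha.1 hlt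
      (fun κ hκ hκb => muBerg_pos hα0 hf hint (ha.1.trans_le hκ) (hne κ hκb))
      (fun t s ht hts hs => muBerg_ineq hα0 hf hint (ha.1.trans_le ht) hts (hne s hs))
    show a ^ (2 / α) * (-1 - muBerg α f a) ≤ b ^ (2 / α) * (-1 - muBerg α f b)
    linarith
  · intro hopt
    have hval : ∀ κ ∈ Set.Ioo 0 (⨆ z : Metric.ball (0 : ℂ) 1, uBerg α f z),
        κ ^ (2 / α) * (-1 - muBerg α f κ) = -1 := by
      intro κ hκ
      have hsup : (⨆ z : Metric.ball (0 : ℂ) 1, uBerg α f z) ≤ 1 :=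
        Real.iSup_le (fun z => uBerg_optimizer_le_one hα0 hopt (mem_ball_zero_iff.1 z.2)) zero_le_one
      linarith [muBerg_optimizer hα0 hκ.1 (hκ.2.trans_le hsup) hopt]
    intro a ha b hb
    rw [hval a ha, hval b hb]
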